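/- There is no set {1, 2, c, d} of four distinct positive integers such that the product of any two distinct elements minus 1 is a perfect square. -/

import Mathlib

/-- divided differences of jets at the nodes -1, 0, 1 -/
noncomputable def dd (f g h : ℕ → ℝ) : ℕ → ℕ → ℕ → ℝ
  | 0, 0, 0 => 0
  | p+1, 0, 0 => f p
  | 0, q+1, 0 => g q
  | 0, 0, r+1 => h r
  | p+1, q+1, r => dd f g h p (q+1) r - dd f g h (p+1) q r
  | 0, q+1, r+1 => dd f g h 0 q (r+1) - dd f g h 0 (q+1) r
  | p+1, 0, r+1 => (dd f g h p 0 (r+1) - dd f g h (p+1) 0 r) / 2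
termination_by p q r => p + q + r

section
variable (f g h : ℕ → ℝ)
lemma dd_000 : dd f g h 0 0 0 = 0 := by rw [dd]
lemma dd_p (p : ℕ) : dd f g h (p+1) 0 0 = f p := by rw [dd]
lemma dd_q (q : ℕ) : dd f g h 0 (q+1) 0 = g q := by rw [dd]
lemma dd_r (r : ℕ) : dd f g h 0 0 (r+1) = h r := by rw [dd]
lemma dd_pq (p q r : ℕ) : dd f g h (p+1) (q+1) r = dd f g h p (q+1) r - dd f g h (p+1) q r := by
  rw [dd]
lemma dd_qr (q r : ℕ) : dd f g h 0 (q+1) (r+1) = dd f g h 0 q (r+1) - dd f g h 0 (q+1) r := by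
  rw [dd]
lemma dd_pr (p r : ℕ) : dd f g h (p+1) 0 (r+1) =
    (dd f g h p 0 (r+1) - dd f g h (p+1) 0 r) / 2 := by
  rw [dd]
end

/-- induction principle following the recursion of `dd` -/
lemma dd_ind {P : ℕ → ℕ → ℕ → Prop} (h0 : P 0 0 0) (h1 : ∀ p, P (p+1) 0 0)
    (h2 : ∀ q, P 0 (q+1) 0) (h3 : ∀ r, P 0 0 (r+1))
    (h4 : ∀ p q r, P p (q+1) r → P (p+1) q r → P (p+1) (q+1) r)
    (h5 : ∀ q r, P 0 q (r+1) → P 0 (q+1) r → P 0 (q+1) (r+1))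
    (h6 : ∀ p r, P p 0 (r+1) → P (p+1) 0 r → P (p+1) 0 (r+1)) (p q r : ℕ) : P p q r :=
  dd.induct P h0 h1 h2 h3 h4 h5 h6 p q r

/-- linearity -/
lemma dd_comb (f g h f' g' h' : ℕ → ℝ) (c d : ℝ) (p q r : ℕ) :
    dd (fun n => c * f n + d * f' n) (fun n => c * g n + d * g' n) (fun n => c * h n + d * h' n) p q r
    = c * dd f g h p q r + d * dd f' g' h' p q r := by
  induction p, q, r using dd_ind with
  | h0 => simp [dd_000]
  | h1 p => simp [dd_p]
  | h2 p => simp [dd_q]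
  | h3 p => simp [dd_r]
  | h4 p q r h1 h2 => simp only [dd_pq, h1, h2]; ring
  | h5 q r h1 h2 => simp only [dd_qr, h1, h2]; ring
  | h6 p r h1 h2 => simp only [dd_pr, h1, h2]; ring

/-- locality -/
lemma dd_congr (f g h f' g' h' : ℕ → ℝ) (p q r : ℕ) (hf : ∀ n < p, f n = f' n)
    (hg : ∀ n < q, g n = g' n) (hh : ∀ n < r, h n = h' n) :
    dd f g h p q r = dd f' g' h' p q r := by
  induction p, q, r using dd_ind with
  | h0 => simp [dd_000]
  | h1 p => simp [dd_p, hf]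
  | h2 p => simp [dd_q, hg]
  | h3 p => simp [dd_r, hh]
  | h4 p q r h1 h2 =>
    rw [dd_pq, dd_pq, h1 (fun n hn => hf n (by omega)) hg hh,
      h2 hf (fun n hn => hg n (by omega)) hh]
  | h5 q r h1 h2 =>
    rw [dd_qr, dd_qr, h1 hf (fun n hn => hg n (by omega)) hh,
      h2 hf hg (fun n hn => hh n (by omega))]
  | h6 p r h1 h2 =>
    rw [dd_pr, dd_pr, h1 (fun n hn => hf n (by omega)) hg hh,
      h2 hf hg (fun n hn => hh n (by omega))]

/-- size bound -/
lemma dd_bound (f g h : ℕ → ℝ) (M : ℝ) (p q r : ℕ) (hM : 0 ≤ M) (hf : ∀ n < p, |f n| ≤ M)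
    (hg : ∀ n < q, |g n| ≤ M) (hh : ∀ n < r, |h n| ≤ M) :
    |dd f g h p q r| ≤ M * (3/2)^p * 3^q * (3/2)^r := by
  have one (n : ℕ) : (1:ℝ) ≤ (3/2)^n := one_le_pow₀ (by norm_num)
  have one' (n : ℕ) : (1:ℝ) ≤ 3^n := one_le_pow₀ (by norm_num)
  induction p, q, r using dd_ind with
  | h0 => simp [dd_000, hM]
  | h1 p =>
    simp only [dd_p, pow_zero, mul_one]
    exact (hf p (by omega)).trans (le_mul_of_one_le_right hM (one _))
  | h2 p =>
    simp only [dd_q, pow_zero, mul_one]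
    exact (hg p (by omega)).trans (le_mul_of_one_le_right hM (one' _))
  | h3 p =>
    simp only [dd_r, pow_zero, mul_one]
    exact (hh p (by omega)).trans (le_mul_of_one_le_right hM (one _))
  | h4 p q r h1 h2 =>
    rw [dd_pq]
    have a1 := h1 (fun n hn => hf n (by omega)) hg hh
    have a2 := h2 hf (fun n hn => hg n (by omega)) hh
    refine (abs_sub _ _).trans ((add_le_add a1 a2).trans (le_of_eq ?_))
    ring
  | h5 q r h1 h2 =>
    rw [dd_qr]
    have a1 := h1 hf (fun n hn => hg n (by omega)) hh
    have a2 := h2 hf hg (fun n hn => hh n (by omega))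
    refine (abs_sub _ _).trans ((add_le_add a1 a2).trans (le_of_eq ?_))
    ring
  | h6 p r h1 h2 =>
    rw [dd_pr, abs_div, abs_two, div_le_iff₀ two_pos]
    have a1 := h1 (fun n hn => hf n (by omega)) hg hh
    have a2 := h2 hf hg (fun n hn => hh n (by omega))
    refine (abs_sub _ _).trans ((add_le_add a1 a2).trans ?_)
    have : 0 ≤ M * (3/2)^p * (3/2)^r := by positivity
    ring_nf at this ⊢
    linarith


/-- integrality, no node at zero -/
lemma dd_int0 (f g h : ℕ → ℝ) (K p q r : ℕ) (hq0 : q = 0) (hp : p ≤ K) (hr : r ≤ K)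
    (hf : ∀ n < p, ∃ z : ℤ, 4^n * f n = z) (hh : ∀ n < r, ∃ z : ℤ, 4^n * h n = z) :
    ∃ z : ℤ, 2^(K+p+r) * dd f g h p q r = z := by
  induction p, q, r using dd_ind with
  | h0 => exact ⟨0, by simp [dd_000]⟩
  | h1 p =>
    obtain ⟨z, hz⟩ := hf p (by omega)
    refine ⟨2^(K+1-p) * z, ?_⟩
    rw [dd_p]; push_cast; rw [← hz, ← mul_assoc]
    congr 1
    rw [show (4:ℝ) = 2^2 by norm_num, ← pow_mul, ← pow_add]
    congr 1; omega
  | h2 p => omega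
  | h3 p =>
    obtain ⟨z, hz⟩ := hh p (by omega)
    refine ⟨2^(K+1-p) * z, ?_⟩
    rw [dd_r]; push_cast; rw [← hz, ← mul_assoc]
    congr 1
    rw [show (4:ℝ) = 2^2 by norm_num, ← pow_mul, ← pow_add]
    congr 1; omega
  | h4 p q r h1 h2 => omega
  | h5 q r h1 h2 => omega
  | h6 p r h1 h2 =>
    obtain ⟨z1, hz1⟩ := h1 rfl (by omega) hr (fun n hn => hf n (by omega)) hh
    obtain ⟨z2, hz2⟩ := h2 rfl hp (by omega) hf (fun n hn => hh n (by omega))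
    refine ⟨z1 - z2, ?_⟩
    push_cast
    rw [dd_pr, ← hz1, ← hz2]
    ring

/-- integrality -/
lemma dd_int (f g h : ℕ → ℝ) (K p q r : ℕ) (hp : p ≤ K) (hq : q ≤ K) (hr : r ≤ K)
    (hf : ∀ n < p, ∃ z : ℤ, 4^n * f n = z)
    (hg : ∀ n < q, ∃ z : ℤ, 4^n * g n = z) (hh : ∀ n < r, ∃ z : ℤ, 4^n * h n = z) :
    ∃ z : ℤ, 2^(3*K) * dd f g h p q r = z := by
  have key : ∀ p r : ℕ, p ≤ K → r ≤ K → (∃ z : ℤ, 2^(K+p+r) * dd f g h p 0 r = z) →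
      ∃ z : ℤ, 2^(3*K) * dd f g h p 0 r = z := by
    rintro p r hp hr ⟨z, hz⟩
    refine ⟨2^(2*K-p-r) * z, ?_⟩
    push_cast
    rw [← hz, ← mul_assoc, ← pow_add]
    congr 2; omega
  induction p, q, r using dd_ind with
  | h0 => exact ⟨0, by simp [dd_000]⟩
  | h1 p => exact key _ _ hp hr (dd_int0 f g h K _ _ _ rfl hp hr hf hh)
  | h2 p =>
    obtain ⟨z, hz⟩ := hg p (by omega)
    refine ⟨2^(3*K-2*p) * z, ?_⟩
    rw [dd_q]; push_cast; rw [← hz, ← mul_assoc]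
    congr 1
    rw [show (4:ℝ) = 2^2 by norm_num, ← pow_mul, ← pow_add]
    congr 1; omega
  | h3 p => exact key _ _ hp hr (dd_int0 f g h K _ _ _ rfl hp hr hf hh)
  | h4 p q r h1 h2 =>
    obtain ⟨z1, hz1⟩ := h1 (by omega) hq hr (fun n hn => hf n (by omega)) hg hh
    obtain ⟨z2, hz2⟩ := h2 hp (by omega) hr hf (fun n hn => hg n (by omega)) hh
    refine ⟨z1 - z2, ?_⟩
    push_cast
    rw [dd_pq, ← hz1, ← hz2]
    ring
  | h5 q r h1 h2 =>
    obtain ⟨z1, hz1⟩ := h1 hp (by omega) hr hf (fun n hn => hg n (by omega)) hh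
    obtain ⟨z2, hz2⟩ := h2 hp hq (by omega) hf hg (fun n hn => hh n (by omega))
    refine ⟨z1 - z2, ?_⟩
    push_cast
    rw [dd_qr, ← hz1, ← hz2]
    ring
  | h6 p r h1 h2 => exact key _ _ hp hr (dd_int0 f g h K _ _ _ rfl hp hr hf hh)

/-- passing to sums of series -/
lemma dd_hasSum (F G H : ℕ → ℕ → ℝ) (c : ℕ → ℝ) (f g h : ℕ → ℝ) (p q r : ℕ)
    (hf : ∀ i < p, HasSum (fun n => c n * F n i) (f i))
    (hg : ∀ i < q, HasSum (fun n => c n * G n i) (g i))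
    (hh : ∀ i < r, HasSum (fun n => c n * H n i) (h i)) :
    HasSum (fun n => c n * dd (F n) (G n) (H n) p q r) (dd f g h p q r) := by
  induction p, q, r using dd_ind with
  | h0 => simpa [dd_000] using hasSum_zero
  | h1 p => simpa [dd_p] using hf p (by omega)
  | h2 p => simpa [dd_q] using hg p (by omega)
  | h3 p => simpa [dd_r] using hh p (by omega)
  | h4 p q r h1 h2 =>
    simp only [dd_pq, mul_sub]
    exact (h1 (fun n hn => hf n (by omega)) hg hh).sub (h2 hf (fun n hn => hg n (by omega)) hh)
  | h5 q r h1 h2 =>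
    simp only [dd_qr, mul_sub]
    exact (h1 hf (fun n hn => hg n (by omega)) hh).sub (h2 hf hg (fun n hn => hh n (by omega)))
  | h6 p r h1 h2 =>
    simp only [dd_pr, mul_sub, mul_div_assoc', sub_div]
    exact ((h1 (fun n hn => hf n (by omega)) hg hh).div_const 2).sub
      ((h2 hf hg (fun n hn => hh n (by omega))).div_const 2)

lemma dd_shift_aux (f g h f₁ g₁ h₁ : ℕ → ℝ) (hf0 : f₁ 0 = - f 0)
    (hf1 : ∀ n, f₁ (n+1) = - f (n+1) + f n)
    (hh0 : h₁ 0 = h 0) (hh1 : ∀ n, h₁ (n+1) = h (n+1) + h n)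
    (p q r : ℕ) (hq : q = 0) :
    (p ≠ 0 → dd f₁ g₁ h₁ p q r = - dd f g h p q r + dd f g h (p-1) q r) ∧
    (r ≠ 0 → dd f₁ g₁ h₁ p q r = dd f g h p q r + dd f g h p q (r-1)) := by
  induction p, q, r using dd_ind with
  | h0 => simp
  | h1 p =>
    rcases p with _ | p
    · simp [dd_p, dd_000, hf0]
    · simp [dd_p, hf1]
  | h2 p => omega
  | h3 p =>
    rcases p with _ | p
    · simp [dd_r, dd_000, hh0]
    · simp [dd_r, hh1]
  | h4 p q r h1 h2 => omega
  | h5 q r h1 h2 => omega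
  | h6 p r h1 h2 =>
    have a1 := (h1 rfl).2 (by omega)
    have a2 := (h2 rfl).1 (by omega)
    simp only [Nat.add_sub_cancel] at a1 a2 ⊢
    rw [dd_pr, dd_pr, a1, a2]
    constructor <;> intro _ <;> ring

lemma dd_shift (f g h f₁ g₁ h₁ : ℕ → ℝ) (hf0 : f₁ 0 = - f 0)
    (hf1 : ∀ n, f₁ (n+1) = - f (n+1) + f n)
    (hg0 : g₁ 0 = 0) (hg1 : ∀ n, g₁ (n+1) = g n)
    (hh0 : h₁ 0 = h 0) (hh1 : ∀ n, h₁ (n+1) = h (n+1) + h n)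
    (p q r : ℕ) (hq : q ≠ 0) :
    dd f₁ g₁ h₁ p q r = dd f g h p (q-1) r := by
  induction p, q, r using dd_ind with
  | h0 => simp at hq
  | h1 p => simp at hq
  | h2 p =>
    rcases p with _ | p
    · simp [dd_q, dd_000, hg0]
    · simp [dd_q, hg1]
  | h3 p => simp at hq
  | h4 p q r h1 h2 =>
    have a1 := h1 (by omega)
    rcases q with _ | q
    · have a2 := (dd_shift_aux f g h f₁ g₁ h₁ hf0 hf1 hh0 hh1 (p+1) 0 r rfl).1 (by omega)
      simp only [Nat.add_sub_cancel] at a1 a2 ⊢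
      rw [dd_pq, a1, a2]; ring
    · have a2 := h2 (by omega)
      simp only [Nat.add_sub_cancel] at a1 a2 ⊢
      rw [dd_pq, a1, a2, dd_pq]
  | h5 q r h1 h2 =>
    have a2 := h2 (by omega)
    rcases q with _ | q
    · have a1 := (dd_shift_aux f g h f₁ g₁ h₁ hf0 hf1 hh0 hh1 0 0 (r+1) rfl).2 (by omega)
      simp only [Nat.add_sub_cancel] at a1 a2 ⊢
      rw [dd_qr, a1, a2]; ring
    · have a1 := h1 (by omega)
      simp only [Nat.add_sub_cancel] at a1 a2 ⊢
      rw [dd_qr, a1, a2, dd_qr]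
  | h6 p r h1 h2 => simp at hq

/-- Taylor coefficients of the monomials at a -/
def mono (a : ℝ) (n i : ℕ) : ℝ := n.choose i * a ^ (n - i)

lemma mono_succ_zero (a : ℝ) (n : ℕ) : mono a (n+1) 0 = a * mono a n 0 := by
  simp [mono, pow_succ]; ring

lemma mono_succ_succ (a : ℝ) (n i : ℕ) :
    mono a (n+1) (i+1) = a * mono a n (i+1) + mono a n i := by
  unfold mono
  rw [Nat.choose_succ_succ, Nat.add_sub_add_right]
  rcases Nat.lt_or_ge i n with h | h
  · rw [show n - i = (n - (i+1)) + 1 by omega]; push_cast; ring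
  · rw [Nat.choose_eq_zero_of_lt (show n < i + 1 by omega)]; push_cast; ring

lemma dd_mono_zero (p q r : ℕ) :
    dd (mono (-1) 0) (mono 0 0) (mono 1 0) p q r = if p + q + r = 1 then 1 else 0 := by
  induction p, q, r using dd_ind with
  | h0 => simp [dd_000]
  | h1 p => rw [dd_p]; rcases p with _ | p <;> simp [mono]
  | h2 p => rw [dd_q]; rcases p with _ | p <;> simp [mono]
  | h3 p => rw [dd_r]; rcases p with _ | p <;> simp [mono]
  | h4 p q r h1 h2 =>
    rw [dd_pq, h1, h2, show p + 1 + q + r = p + (q + 1) + r by ring, sub_self, if_neg (by omega)]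
  | h5 q r h1 h2 =>
    rw [dd_qr, h1, h2, show 0 + (q + 1) + r = 0 + q + (r+1) by ring, sub_self, if_neg (by omega)]
  | h6 p r h1 h2 =>
    rw [dd_pr, h1, h2, show p + 1 + 0 + r = p + 0 + (r+1) by ring, sub_self, if_neg (by omega)]
    simp

lemma dd_mono_bound (n p q r m : ℕ) (hm : p + q + r = m + 1) :
    |dd (mono (-1) n) (mono 0 n) (mono 1 n) p q r| ≤ n.choose m := by
  induction n generalizing p q r m with
  | zero =>
    rw [dd_mono_zero]
    rcases m with _ | m
    · simp [hm]
    · simp [hm]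
  | succ n ih =>
    have hf0 : mono (-1) (n+1) 0 = - mono (-1) n 0 := by rw [mono_succ_zero]; ring
    have hf1 : ∀ i, mono (-1) (n+1) (i+1) = - mono (-1) n (i+1) + mono (-1) n i := by
      intro i; rw [mono_succ_succ]; ring
    have hg0 : mono 0 (n+1) 0 = 0 := by rw [mono_succ_zero]; ring
    have hg1 : ∀ i, mono 0 (n+1) (i+1) = mono 0 n i := by
      intro i; rw [mono_succ_succ]; ring
    have hh0 : mono 1 (n+1) 0 = mono 1 n 0 := by rw [mono_succ_zero]; ring
    have hh1 : ∀ i, mono 1 (n+1) (i+1) = mono 1 n (i+1) + mono 1 n i := by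
      intro i; rw [mono_succ_succ]; ring
    have main : ∃ p' q' r', p' + q' + r' = m ∧
        |dd (mono (-1) (n+1)) (mono 0 (n+1)) (mono 1 (n+1)) p q r| ≤
        |dd (mono (-1) n) (mono 0 n) (mono 1 n) p q r| +
        |dd (mono (-1) n) (mono 0 n) (mono 1 n) p' q' r'| := by
      by_cases hq : q = 0
      · have := dd_shift_aux (mono (-1) n) (mono 0 n) (mono 1 n) _ (mono 0 (n+1)) _ hf0 hf1 hh0 hh1 p q r hq
        by_cases hp : p = 0
        · refine ⟨p, q, r-1, by omega, ?_⟩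
          rw [this.2 (by omega)]
          exact abs_add_le _ _
        · refine ⟨p-1, q, r, by omega, ?_⟩
          rw [this.1 (by omega)]
          refine (abs_add_le _ _).trans ?_
          rw [abs_neg]
      · refine ⟨p, q-1, r, by omega, ?_⟩
        rw [dd_shift _ _ _ _ _ _ hf0 hf1 hg0 hg1 hh0 hh1 p q r hq]
        exact le_add_of_nonneg_left (abs_nonneg _)
    obtain ⟨p', q', r', h', hle⟩ := main
    refine hle.trans ?_
    have b1 := ih p q r m hm
    rcases m with _ | m
    · obtain ⟨rfl, rfl, rfl⟩ : p' = 0 ∧ q' = 0 ∧ r' = 0 := by omega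
      simp [dd_000] at b1 ⊢
      exact b1
    · have b2 := ih p' q' r' m h'
      rw [Nat.choose_succ_succ]; push_cast; linarith

/-- effect of a single top order jet -/
lemma dd_top_zero (f g h : ℕ → ℝ) (K p q r : ℕ) (hp : p ≤ K) (hq : q ≤ K) (hr : r ≤ K)
    (hf : ∀ n < K, f n = 0) (hg : ∀ n < K, g n = 0) (hh : ∀ n < K, h n = 0) :
    dd f g h p q r = 0 := by
  have := dd_bound f g h 0 p q r le_rfl (fun n hn => by simp [hf n (by omega)])
    (fun n hn => by simp [hg n (by omega)]) (fun n hn => by simp [hh n (by omega)])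
  simpa using this

lemma dd_top_f (f g h : ℕ → ℝ) (K q r : ℕ) (hq : q ≤ K) (hr : r ≤ K)
    (hf : ∀ n < K, f n = 0) (hg : ∀ n < K, g n = 0) (hh : ∀ n < K, h n = 0)
    (h0 : dd f g h (K+1) q r = 0) : f K = 0 := by
  induction q with
  | zero =>
    induction r with
    | zero => simpa [dd_p] using h0
    | succ r ih =>
      apply ih (by omega)
      rw [dd_pr, dd_top_zero f g h K K 0 (r+1) le_rfl hq hr hf hg hh] at h0
      linarith
  | succ q ih =>
    apply ih (by omega)
    rw [dd_pq, dd_top_zero f g h K K (q+1) r le_rfl hq hr hf hg hh] at h0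
    linarith

lemma dd_top_g (f g h : ℕ → ℝ) (K p r : ℕ) (hp : p ≤ K) (hr : r ≤ K)
    (hf : ∀ n < K, f n = 0) (hg : ∀ n < K, g n = 0) (hh : ∀ n < K, h n = 0)
    (h0 : dd f g h p (K+1) r = 0) : g K = 0 := by
  induction p with
  | zero =>
    induction r with
    | zero => simpa [dd_q] using h0
    | succ r ih =>
      apply ih (by omega)
      rw [dd_qr, dd_top_zero f g h K 0 K (r+1) hp le_rfl hr hf hg hh] at h0
      linarith
  | succ q ih =>
    apply ih (by omega)
    rw [dd_pq, dd_top_zero f g h K (q+1) K r hp le_rfl hr hf hg hh] at h0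
    linarith

lemma dd_top_h_eq (f g h : ℕ → ℝ) (K p q r : ℕ) (hr0 : r = K + 1) (hp : p ≤ K) (hq : q ≤ K)
    (hf : ∀ n < K, f n = 0) (hg : ∀ n < K, g n = 0) (hh : ∀ n < K, h n = 0) :
    dd f g h p q r = h K / 2^p := by
  induction p, q, r using dd_ind with
  | h0 => omega
  | h1 p => omega
  | h2 p => omega
  | h3 p => obtain rfl : p = K := by omega
            simp [dd_r]
  | h4 p q r h1 h2 =>
    rw [dd_pq, h1 hr0 (by omega) hq, h2 hr0 hp (by omega), pow_succ]; field_simp; ring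
  | h5 q r h1 h2 =>
    obtain rfl : r = K := by omega
    rw [dd_qr, h1 hr0 hp (by omega), dd_top_zero f g h r 0 (q+1) r hp hq le_rfl hf hg hh]; ring
  | h6 p r h1 h2 =>
    obtain rfl : r = K := by omega
    rw [dd_pr, h1 hr0 (by omega) hq, dd_top_zero f g h r (p+1) 0 r hp hq le_rfl hf hg hh, pow_succ]
    field_simp; ring

lemma dd_top_h (f g h : ℕ → ℝ) (K p q : ℕ) (hp : p ≤ K) (hq : q ≤ K)
    (hf : ∀ n < K, f n = 0) (hg : ∀ n < K, g n = 0) (hh : ∀ n < K, h n = 0)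
    (h0 : dd f g h p q (K+1) = 0) : h K = 0 := by
  rw [dd_top_h_eq f g h K p q _ rfl hp hq hf hg hh] at h0
  simpa using h0

open Polynomial in
/-- a polynomial of degree less than `3 * K` vanishing to order K at -1, 0, 1 is zero -/
lemma poly_zero (K : ℕ) (Q : ℝ[X]) (hd : Q.degree < (3*K : ℕ))
    (h1 : ∀ i < K, (taylor (-1) Q).coeff i = 0) (h2 : ∀ i < K, (taylor 0 Q).coeff i = 0)
    (h3 : ∀ i < K, (taylor 1 Q).coeff i = 0) : Q = 0 := by
  have dv : ∀ a : ℝ, (∀ i < K, (taylor a Q).coeff i = 0) → (X - C a)^K ∣ Q := by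
    intro a ha
    rw [X_sub_C_pow_dvd_iff, X_pow_dvd_iff]
    intro d hd
    rw [← taylor_apply]; exact ha d hd
  have cop : ∀ a b : ℝ, a ≠ b → IsCoprime ((X - C a)^K) ((X - C b)^K) := by
    intro a b hab
    exact (isCoprime_X_sub_C_of_isUnit_sub (sub_ne_zero.2 hab).isUnit).pow
  have e1 := (cop (-1) 0 (by norm_num)).mul_dvd (dv _ h1) (dv _ h2)
  have e2 := IsCoprime.mul_dvd ((cop (-1) 1 (by norm_num)).mul_left (cop 0 1 (by norm_num))) e1 (dv _ h3)
  by_contra hQ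
  have := degree_le_of_dvd e2 hQ
  rw [degree_mul, degree_mul, degree_pow, degree_pow, degree_pow, degree_X_sub_C,
    degree_X_sub_C, degree_X_sub_C] at this
  have h := this.trans_lt hd
  simp at h
  norm_cast at h
  omega

open Polynomial in
lemma interp (K : ℕ) (f g h : ℕ → ℝ) : ∃ Q : ℝ[X], Q.degree < (3*K : ℕ) ∧
    (∀ i < K, (taylor (-1) Q).coeff i = f i) ∧ (∀ i < K, (taylor 0 Q).coeff i = g i) ∧
    (∀ i < K, (taylor 1 Q).coeff i = h i) := by
  let J : ℝ → ℝ[X] →ₗ[ℝ] (Fin K → ℝ) := fun a =>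
    LinearMap.pi (fun i => (lcoeff ℝ (i:ℕ)).comp (taylor a))
  let L : (degreeLT ℝ (3*K)) →ₗ[ℝ] ((Fin K → ℝ) × (Fin K → ℝ) × (Fin K → ℝ)) :=
    ((J (-1)).prod ((J 0).prod (J 1))).comp (Submodule.subtype _)
  have hfr : Module.finrank ℝ (degreeLT ℝ (3*K)) =
      Module.finrank ℝ ((Fin K → ℝ) × (Fin K → ℝ) × (Fin K → ℝ)) := by
    rw [(degreeLTEquiv ℝ (3*K)).finrank_eq]
    simp; ring
  have : FiniteDimensional ℝ (degreeLT ℝ (3*K)) :=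
    Module.Finite.equiv (degreeLTEquiv ℝ (3*K)).symm
  have inj : Function.Injective L := by
    rw [← LinearMap.ker_eq_bot, LinearMap.ker_eq_bot']
    rintro ⟨Q, hQ⟩ h0
    rw [mem_degreeLT] at hQ
    have h1 := congrArg Prod.fst h0
    have h2 := congrArg (fun x => x.2.1) h0
    have h3 := congrArg (fun x => x.2.2) h0
    have : Q = 0 := by
      apply poly_zero K Q hQ
      · intro i hi; exact congrFun h1 ⟨i, hi⟩
      · intro i hi; exact congrFun h2 ⟨i, hi⟩
      · intro i hi; exact congrFun h3 ⟨i, hi⟩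
    subst this; rfl
  have surj := (LinearMap.injective_iff_surjective_of_finrank_eq_finrank hfr).1 inj
  obtain ⟨⟨Q, hQ⟩, hL⟩ := surj (fun i => f i, fun i => g i, fun i => h i)
  refine ⟨Q, mem_degreeLT.1 hQ, ?_, ?_, ?_⟩
  · intro i hi; exact congrFun (congrArg Prod.fst hL) ⟨i, hi⟩
  · intro i hi; exact congrFun (congrArg (fun x => x.2.1) hL) ⟨i, hi⟩
  · intro i hi; exact congrFun (congrArg (fun x => x.2.2) hL) ⟨i, hi⟩

open Polynomial in
lemma taylor_hasSum (Q : ℝ[X]) (a : ℝ) (i : ℕ) :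
    HasSum (fun n => Q.coeff n * mono a n i) ((taylor a Q).coeff i) := by
  have : (taylor a Q).coeff i = ∑ n ∈ Finset.range (Q.natDegree + 1), Q.coeff n * mono a n i := by
    conv_lhs => rw [Q.as_sum_range_C_mul_X_pow]
    rw [map_sum, finsetSum_coeff]
    refine Finset.sum_congr rfl fun n _ => ?_
    rw [taylor_apply]
    simp only [mul_comp, C_comp, pow_comp, X_comp, coeff_C_mul, coeff_X_add_C_pow, mono]
    ring
  rw [this]
  apply hasSum_sum_of_ne_finset_zero
  intro n hn
  rw [Finset.mem_range, not_lt] at hn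
  rw [coeff_eq_zero_of_natDegree_lt (by omega), zero_mul]

open Polynomial in
lemma dd_poly (Q : ℝ[X]) (p q r m : ℕ) (hm : p + q + r = m + 1) (hd : Q.degree < (m : ℕ)) :
    dd (taylor (-1) Q).coeff (taylor 0 Q).coeff (taylor 1 Q).coeff p q r = 0 := by
  have := dd_hasSum (mono (-1)) (mono 0) (mono 1) Q.coeff _ _ _ p q r
    (fun i _ => taylor_hasSum Q (-1) i) (fun i _ => taylor_hasSum Q 0 i)
    (fun i _ => taylor_hasSum Q 1 i)
  have z : (fun n => Q.coeff n * dd (mono (-1) n) (mono 0 n) (mono 1 n) p q r) = fun _ => 0 := by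
    funext n
    rcases lt_or_ge n m with h | h
    · have := dd_mono_bound n p q r m hm
      rw [Nat.choose_eq_zero_of_lt h] at this
      simp at this
      rw [this, mul_zero]
    · rw [coeff_eq_zero_of_degree_lt, zero_mul]
      exact hd.trans_le (by exact_mod_cast h)
  rw [z] at this
  exact this.unique hasSum_zero

open Polynomial in
lemma nonvanish (K : ℕ) (hK : 0 < K) (N : ℝ) (hN : 1 < N) (f g h : ℕ → ℝ)
    (hf : ∀ i < K, (N - 1) * (i+1) * f (i+1) + i * f i = (K + 1/2) * f i)
    (hg : ∀ i < K, N * (i+1) * g (i+1) + i * g i = (K + 1/2) * g i)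
    (hh : ∀ i < K, (N + 1) * (i+1) * h (i+1) + i * h i = (K + 1/2) * h i)
    (h1 : dd f g h (K+1) K K = 0) (h2 : dd f g h K (K+1) K = 0) (h3 : dd f g h K K (K+1) = 0) :
    g 0 = 0 := by
  obtain ⟨Q, hd, q1, q2, q3⟩ := interp K f g h
  have comb : ∀ p q r, p + q + r = 3*K+1 → dd f g h p q r = 0 →
      dd (fun n => 1 * f n + (-1) * (taylor (-1) Q).coeff n)
        (fun n => 1 * g n + (-1) * (taylor 0 Q).coeff n)
        (fun n => 1 * h n + (-1) * (taylor 1 Q).coeff n) p q r = 0 := by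
    intro p q r hp h0
    rw [dd_comb, h0, dd_poly Q p q r _ hp hd]; simp
  have v1 := dd_top_f _ _ _ K K K le_rfl le_rfl (fun n hn => by simp [q1 n hn])
    (fun n hn => by simp only [q2 n hn]; ring) (fun n hn => by simp [q3 n hn]) (comb _ _ _ (by ring) h1)
  have v2 := dd_top_g _ _ _ K K K le_rfl le_rfl (fun n hn => by simp [q1 n hn])
    (fun n hn => by simp only [q2 n hn]; ring) (fun n hn => by simp [q3 n hn]) (comb _ _ _ (by ring) h2)
  have v3 := dd_top_h _ _ _ K K K le_rfl le_rfl (fun n hn => by simp [q1 n hn])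
    (fun n hn => by simp only [q2 n hn]; ring) (fun n hn => by simp [q3 n hn]) (comb _ _ _ (by ring) h3)
  have w1 : ∀ i ≤ K, (taylor (-1) Q).coeff i = f i := by
    intro i hi
    rcases hi.lt_or_eq with h | rfl
    · exact q1 i h
    · linarith
  have w2 : ∀ i ≤ K, (taylor 0 Q).coeff i = g i := by
    intro i hi
    rcases hi.lt_or_eq with h | rfl
    · exact q2 i h
    · linarith
  have w3 : ∀ i ≤ K, (taylor 1 Q).coeff i = h i := by
    intro i hi
    rcases hi.lt_or_eq with h | rfl
    · exact q3 i h
    · linarith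
  set D : ℝ[X] := X * derivative Q + C N * derivative Q - C ((K:ℝ) + 1/2) * Q with hD
  have cD : ∀ (a : ℝ) (i : ℕ), (taylor a D).coeff i =
      (N + a) * (i+1) * (taylor a Q).coeff (i+1) + i * (taylor a Q).coeff i
        - (K+1/2) * (taylor a Q).coeff i := by
    intro a i
    have hder : taylor a (derivative Q) = derivative (taylor a Q) := by
      simp [taylor_apply, derivative_comp]
    rw [hD, map_sub, map_add, taylor_mul, taylor_mul, taylor_mul, taylor_C, taylor_C, taylor_X, hder]
    rw [add_mul]
    simp only [coeff_add, coeff_sub, coeff_C_mul, coeff_derivative]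
    rcases i with _ | i
    · simp; ring
    · rw [coeff_X_mul, coeff_derivative]; push_cast; ring
  have Dc : ∀ i : ℕ, D.coeff i = N * (i+1) * Q.coeff (i+1) + i * Q.coeff i - (K+1/2) * Q.coeff i := by
    intro i; have := cD 0 i; simpa using this
  have D0 : D = 0 := by
    apply poly_zero K
    · rw [degree_lt_iff_coeff_zero] at hd ⊢
      intro m hm
      rw [Dc, hd m hm, hd (m+1) (by omega)]; ring
    · intro i hi; rw [cD, w1 i (by omega), w1 (i+1) (by omega)]; linarith [hf i hi]
    · intro i hi; rw [cD, w2 i (by omega), w2 (i+1) (by omega)]; linarith [hg i hi]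
    · intro i hi; rw [cD, w3 i (by omega), w3 (i+1) (by omega)]; linarith [hh i hi]
  have Q0 : Q = 0 := by
    have := Dc Q.natDegree
    rw [D0, coeff_eq_zero_of_natDegree_lt (Nat.lt_succ_self Q.natDegree), coeff_zero] at this
    have e : ((Q.natDegree:ℝ) - (K + 1/2)) * Q.coeff Q.natDegree = 0 := by linarith
    rcases mul_eq_zero.1 e with e | e
    · exfalso
      have : (2 * Q.natDegree : ℝ) = 2 * K + 1 := by linarith
      norm_cast at this; omega
    · exact leadingCoeff_eq_zero.1 e
  have := w2 0 (by omega)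
  rw [Q0] at this
  simpa using this.symm

lemma rc_rec (a : ℝ) (n : ℕ) :
    (n+1) * Ring.choose a (n+1) = (a - n) * Ring.choose a n := by
  have := Ring.choose_smul_choose a (n := n+1) (k := n) (by omega)
  rw [Nat.add_sub_cancel_left, Ring.choose_one_right, Nat.choose_succ_self_right, nsmul_eq_mul] at this
  push_cast at this
  rw [this]; ring

lemma rc_succ (a : ℝ) (n : ℕ) :
    (n+1) * Ring.choose (a+1) (n+1) = (a + 1) * Ring.choose a n := by
  have := Ring.choose_add_smul_choose a n 1
  rw [Nat.choose_one_right, nsmul_eq_mul] at this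
  push_cast at this
  rw [this, Ring.choose_one_right]

lemma rc_neg_half (n : ℕ) : 4^n * Ring.choose (-1/2 : ℝ) n = (-1)^n * Nat.centralBinom n := by
  induction n with
  | zero => simp
  | succ n ih =>
    have h1 := rc_rec (-1/2) n
    have h2 : ((n:ℝ)+1) * Nat.centralBinom (n+1) = 2*(2*n+1) * Nat.centralBinom n := by
      exact_mod_cast Nat.succ_mul_centralBinom_succ n
    have h0 : ((n:ℝ)+1) ≠ 0 := by positivity
    apply mul_left_cancel₀ h0
    calc ((n:ℝ)+1) * (4^(n+1) * Ring.choose (-1/2 : ℝ) (n+1))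
        = 4^(n+1) * ((n+1) * Ring.choose (-1/2 : ℝ) (n+1)) := by ring
      _ = 4 * (-1/2-n) * (4^n * Ring.choose (-1/2 : ℝ) n) := by rw [h1]; ring
      _ = (-1)^(n+1) * (2*(2*n+1) * Nat.centralBinom n) := by rw [ih]; ring
      _ = _ := by rw [← h2]; ring

lemma rc_int (K n : ℕ) : ∃ z : ℤ, 4^n * Ring.choose ((K:ℝ) - 1/2) n = z := by
  induction K generalizing n with
  | zero =>
    refine ⟨(-1)^n * Nat.centralBinom n, ?_⟩
    have := rc_neg_half n
    push_cast
    rw [← this]; norm_num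
  | succ K ih =>
    rcases n with _ | n
    · exact ⟨1, by simp⟩
    · obtain ⟨z1, h1⟩ := ih n
      obtain ⟨z2, h2⟩ := ih (n+1)
      refine ⟨4 * z1 + z2, ?_⟩
      have := Ring.choose_succ_succ ((K:ℝ) - 1/2) n
      push_cast
      rw [show (K:ℝ) + 1 - 1/2 = (K - 1/2) + 1 by ring, this, ← h1, ← h2]
      ring

lemma rc_int' (K n : ℕ) : ∃ z : ℤ, 4^n * Ring.choose ((K:ℝ) + 1/2) n = z := by
  have := rc_int (K+1) n
  rwa [show ((K+1 : ℕ):ℝ) - 1/2 = K + 1/2 by push_cast; ring] at this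

lemma rc_bounds (K n : ℕ) (hn : n ≤ K + 1) : 0 ≤ Ring.choose ((K:ℝ) + 1/2) n ∧
    Ring.choose ((K:ℝ) + 1/2) n ≤ (K+1).choose n := by
  induction n with
  | zero => simp
  | succ n ih =>
    obtain ⟨i1, i2⟩ := ih (by omega)
    have h1 := rc_rec ((K:ℝ) + 1/2) n
    have h2 : (((K+1).choose (n+1) : ℕ) : ℝ) * (n+1) = (K+1).choose n * (K + 1 - n) := by
      have := Nat.choose_succ_right_eq (K+1) n
      have h3 : (((K + 1 - n : ℕ)) : ℝ) = K + 1 - n := by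
        rw [Nat.cast_sub (by omega)]; push_cast; ring
      rw [← h3]; exact_mod_cast this
    have hn' : (n:ℝ) ≤ K := by exact_mod_cast (by omega : n ≤ K)
    have h0 : (0:ℝ) < (n:ℝ)+1 := by positivity
    constructor
    · have : 0 ≤ ((n:ℝ)+1) * Ring.choose ((K:ℝ) + 1/2) (n+1) := by
        rw [h1]; apply mul_nonneg _ i1; linarith
      exact nonneg_of_mul_nonneg_right this h0
    · apply le_of_mul_le_mul_left _ h0
      rw [h1, mul_comm ((n:ℝ)+1), h2, mul_comm _ ((K:ℝ)+1-n)]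
      apply mul_le_mul _ i2 i1 <;> linarith

lemma rc_anti (K n : ℕ) (hn : 3*K ≤ n) :
    |Ring.choose ((K:ℝ) + 1/2) n| ≤ |Ring.choose ((K:ℝ) + 1/2) (3*K)| := by
  induction n, hn using Nat.le_induction with
  | base => exact le_rfl
  | succ n hn ih =>
    refine le_trans ?_ ih
    have h1 := rc_rec ((K:ℝ) + 1/2) n
    have h0 : (0:ℝ) < (n:ℝ)+1 := by positivity
    have hK : (K:ℝ) ≤ n := by exact_mod_cast (by omega : K ≤ n)
    have hK0 : (0:ℝ) ≤ K := by positivity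
    apply le_of_mul_le_mul_left _ h0
    have : ((n:ℝ)+1) * |Ring.choose ((K:ℝ) + 1/2) (n+1)| = |(K:ℝ)+1/2-n| * |Ring.choose ((K:ℝ) + 1/2) n| := by
      rw [← abs_mul, ← h1, abs_mul, abs_of_pos h0]
    rw [this]
    apply mul_le_mul_of_nonneg_right _ (abs_nonneg _)
    rw [abs_le]; constructor <;> linarith

lemma rc_3K (K : ℕ) : |Ring.choose ((K:ℝ) + 1/2) (3*K)| ≤ (1/4)^K := by
  induction K with
  | zero => simp
  | succ K ih =>
    have h1 := rc_succ ((K:ℝ)+1/2) (3*K+2)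
    have h2 := rc_rec ((K:ℝ)+1/2) (3*K+1)
    have h3 := rc_rec ((K:ℝ)+1/2) (3*K)
    push_cast at h1 h2 h3 ⊢
    rw [show 3*(K+1) = 3*K+2+1 by ring, show (K:ℝ)+1+1/2 = K+1/2+1 by ring]
    have hK0 : (0:ℝ) ≤ K := by positivity
    have key : (3*(K:ℝ)+2+1)*(3*K+1+1)*(3*K+1) * Ring.choose ((K:ℝ)+1/2+1) (3*K+2+1)
        = (K+1/2+1)*((K+1/2-(3*K+1))*((K+1/2-3*K))) * Ring.choose ((K:ℝ)+1/2) (3*K) := by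
      calc _ = (3*K+1+1)*(3*K+1)* ((3*(K:ℝ)+2+1)* Ring.choose ((K:ℝ)+1/2+1) (3*K+2+1)) := by ring
        _ = (K+1/2+1)*(3*K+1) * ((3*K+1+1)* Ring.choose ((K:ℝ)+1/2) (3*K+1+1)) := by rw [h1]; ring
        _ = (K+1/2+1)*(K+1/2-(3*K+1)) * ((3*K+1)* Ring.choose ((K:ℝ)+1/2) (3*K+1)) := by rw [h2]; ring
        _ = _ := by rw [h3]; ring
    have key2 := congrArg abs key
    rw [abs_mul _ (Ring.choose _ _), abs_mul _ (Ring.choose _ _), abs_of_pos (show (0:ℝ) < (3*(K:ℝ)+2+1)*(3*K+1+1)*(3*K+1) by positivity)] at key2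
    apply le_of_mul_le_mul_left _ (show (0:ℝ) < (3*(K:ℝ)+2+1)*(3*K+1+1)*(3*K+1) by positivity)
    rw [key2, pow_succ, show ∀ w : ℝ, w * ((1/4)^K * (1/4)) = w * (1/4) * (1/4)^K by intro w; ring]
    refine mul_le_mul ?_ ih (abs_nonneg _) (by positivity)
    have : 0 ≤ (K:ℝ)^2 := by positivity
    have : 0 ≤ (K:ℝ)^3 := by positivity
    rw [abs_le]
    constructor <;> nlinarith

lemma HasSum.congr_fun_eq {f g : ℕ → ℝ} {a : ℝ} (h : HasSum f a) (e : ∀ n, g n = f n) :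
    HasSum g a := by
  rw [show g = f from funext e]; exact h

lemma rc_hasSum (b y : ℝ) (hy : |y| < 1) :
    HasSum (fun n => Ring.choose b n * y^n) ((1+y)^b) := by
  have := (Real.one_add_rpow_hasFPowerSeriesOnBall_zero (a := b)).hasSum_sub (y := y) (by
    rw [Metric.mem_eball, edist_zero_right]
    rw [← ofReal_norm, Real.norm_eq_abs]
    exact ENNReal.ofReal_lt_one.2 hy)
  simpa [binomialSeries, FormalMultilinearSeries.ofScalars, smul_eq_mul] using this

lemma jets_hasSum (K i : ℕ) (a x : ℝ) (hi : i ≤ K) (hx : |a * x| < 1) :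
    HasSum (fun n => (Ring.choose ((K:ℝ)+1/2) n * x^n) * mono a n i)
      (Ring.choose ((K:ℝ)+1/2) i * x^i * ((1+a*x)^(K-i) * Real.sqrt (1+a*x))) := by
  rw [← hasSum_nat_add_iff' i]
  have z : ∑ j ∈ Finset.range i, (Ring.choose ((K:ℝ)+1/2) j * x^j) * mono a j i = 0 := by
    apply Finset.sum_eq_zero
    intro j hj
    rw [mono, Nat.choose_eq_zero_of_lt (Finset.mem_range.1 hj)]; simp
  rw [z, sub_zero]
  have h := (rc_hasSum ((K:ℝ)+1/2 - i) (a*x) hx).mul_left (Ring.choose ((K:ℝ)+1/2) i * x^i)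
  have pos : 0 < 1 + a*x := by linarith [(abs_lt.1 hx).1]
  have e : (1+a*x)^((K:ℝ)+1/2-i) = (1+a*x)^(K-i) * Real.sqrt (1+a*x) := by
    rw [Real.sqrt_eq_rpow, ← Real.rpow_natCast, ← Real.rpow_add pos, Nat.cast_sub hi]
    congr 1; ring
  rw [e] at h
  refine h.congr_fun_eq ?_
  intro n
  have := Ring.choose_smul_choose ((K:ℝ)+1/2) (n := n+i) (k := i) (by omega)
  rw [Nat.add_sub_cancel, nsmul_eq_mul] at this
  rw [mono, Nat.add_sub_cancel, mul_pow, pow_add]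
  linear_combination (x^n * x^i * a^n) * this

lemma choose_geom (m : ℕ) (x : ℝ) (h0 : 0 ≤ x) (h1 : x < 1) :
    HasSum (fun n => (n.choose m : ℝ) * x^n) (x^m / (1-x)^(m+1)) := by
  rw [← hasSum_nat_add_iff' m]
  have z : ∑ j ∈ Finset.range m, (j.choose m : ℝ) * x^j = 0 := by
    apply Finset.sum_eq_zero
    intro j hj
    rw [Nat.choose_eq_zero_of_lt (Finset.mem_range.1 hj)]; simp
  rw [z, sub_zero]
  have := (hasSum_choose_mul_geometric_of_norm_lt_one (𝕜 := ℝ) m (r := x)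
    (by rw [Real.norm_eq_abs, abs_of_nonneg h0]; exact h1)).mul_left (x^m)
  rw [show x^m * (1 / (1-x)^(m+1)) = x^m / (1-x)^(m+1) by ring] at this
  refine this.congr_fun_eq ?_
  intro n; rw [pow_add]; ring

/-- the jets of `x ↦ (1+ax)^(K+1/2)` -/
noncomputable def gj (K : ℕ) (x a : ℝ) (i : ℕ) : ℝ :=
  Ring.choose ((K:ℝ)+1/2) i * x^i * ((1+a*x)^(K-i) * Real.sqrt (1+a*x))

lemma gj_bound (K p q r : ℕ) (x : ℝ) (h0 : 0 ≤ x) (h1 : x < 1) (hm : p + q + r = 3*K+1)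
    (hp : p ≤ K + 1) (hq : q ≤ K + 1) (hr : r ≤ K + 1) :
    |dd (gj K x (-1)) (gj K x 0) (gj K x 1) p q r| ≤ (1/4)^K * (x^(3*K) / (1-x)^(3*K+1)) := by
  have hs := dd_hasSum (mono (-1)) (mono 0) (mono 1) (fun n => Ring.choose ((K:ℝ)+1/2) n * x^n)
    (gj K x (-1)) (gj K x 0) (gj K x 1) p q r
    (fun i hi => jets_hasSum K i _ x (by omega) (by simpa [abs_of_nonneg h0] using h1))
    (fun i hi => jets_hasSum K i _ x (by omega) (by simp))
    (fun i hi => jets_hasSum K i _ x (by omega) (by simpa [abs_of_nonneg h0] using h1))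
  have hb := (choose_geom (3*K) x h0 h1).mul_left ((1/4:ℝ)^K)
  rw [← Real.norm_eq_abs]
  refine hs.norm_le_of_bounded hb ?_
  intro n
  rw [Real.norm_eq_abs, abs_mul, abs_mul, abs_of_nonneg (pow_nonneg h0 n)]
  have b1 := dd_mono_bound n p q r _ hm
  rcases lt_or_ge n (3*K) with h | h
  · rw [Nat.choose_eq_zero_of_lt h] at b1 ⊢
    simp only [Nat.cast_zero] at b1 ⊢
    rw [le_antisymm b1 (abs_nonneg _)]; simp
  · have b2 := (rc_anti K n h).trans (rc_3K K)
    have hxn := pow_nonneg h0 n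
    calc _ ≤ (1/4)^K * x^n * (n.choose (3*K) : ℝ) := by gcongr
      _ = _ := by ring


lemma near_sqrt (y w B : ℝ) (hy : 0 ≤ y) (hw : 0 < w) (h1 : y^2 - w^2 ≤ B*w) (h2 : w^2 - y^2 ≤ B*w) :
    |y - w| ≤ B := by
  have hB : 0 ≤ B := by
    by_contra hB
    nlinarith
  rw [abs_le]; constructor <;> by_contra hc <;> push Not at hc <;> nlinarith

lemma choose_mul_pow_le (n i : ℕ) (y : ℝ) (hy : 0 ≤ y) (hi : i ≤ n) :
    (n.choose i : ℝ) * y^(n-i) ≤ (y+1)^n := by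
  rw [add_comm, add_pow]
  have := Finset.single_le_sum (s := Finset.range (n+1))
    (f := fun m => (1:ℝ)^m * y^(n-m) * (n.choose m : ℝ)) (fun m _ => by positivity)
    (Finset.mem_range.2 (Nat.lt_succ_of_le hi))
  refine le_trans (le_of_eq ?_) this
  simp; ring

/-- the integer scaled jets -/
noncomputable def Fj (K : ℕ) (P N a : ℝ) (i : ℕ) : ℝ :=
  P * (Ring.choose ((K:ℝ)+1/2) i * (N+a)^(K-i))

lemma Fj_int (K : ℕ) (P M : ℤ) (N a : ℝ) (hM : N + a = M) (i : ℕ) :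
    ∃ z : ℤ, 4^i * Fj K P N a i = z := by
  obtain ⟨w, hw⟩ := rc_int' K i
  refine ⟨P * w * M^(K-i), ?_⟩
  push_cast
  rw [← hw, Fj, hM]; ring

lemma Fj_rec (K : ℕ) (P N a : ℝ) (i : ℕ) (hi : i < K) :
    (N + a) * (i+1) * Fj K P N a (i+1) + i * Fj K P N a i = (K+1/2) * Fj K P N a i := by
  have h := rc_rec ((K:ℝ)+1/2) i
  unfold Fj
  rw [show K - i = (K-(i+1)) + 1 by omega, pow_succ]
  linear_combination (P * (N+a)^(K-(i+1)) * (N+a)) * h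

lemma Fj_split (K : ℕ) (P Q N a : ℝ) (hN : 0 < N) (i : ℕ) (hi : i ≤ K) :
    Fj K P N a i = (N^K * Q) * gj K N⁻¹ a i +
      1 * Fj K (P - Real.sqrt (1 + a * N⁻¹) * Q) N a i := by
  have : N^K * ((N⁻¹)^i * (1+a*N⁻¹)^(K-i)) = (N+a)^(K-i) := by
    obtain ⟨j, rfl⟩ := Nat.exists_eq_add_of_le hi
    rw [Nat.add_sub_cancel_left, pow_add,
      show N^i * N^j * ((N⁻¹)^i * (1+a*N⁻¹)^j) = (N*N⁻¹)^i * (N * (1+a*N⁻¹))^j by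
        rw [mul_pow, mul_pow]; ring]
    rw [mul_inv_cancel₀ hN.ne', one_pow, one_mul, mul_add, mul_one]
    congr 2
    field_simp
  unfold Fj gj
  rw [← this]; ring

lemma Fj_le (K : ℕ) (P N a B : ℝ) (hN : 1 ≤ N) (ha : |a| ≤ 1) (hP : |P| ≤ B) (i : ℕ) (hi : i ≤ K) :
    |Fj K P N a i| ≤ B * (N+2)^(K+1) := by
  obtain ⟨b1, b2⟩ := rc_bounds K i (by omega)
  obtain ⟨a1, a2⟩ := abs_le.1 ha
  unfold Fj
  rw [abs_mul]
  apply mul_le_mul hP _ (abs_nonneg _) ((abs_nonneg _).trans hP)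
  rw [abs_of_nonneg (mul_nonneg b1 (pow_nonneg (by linarith) _))]
  have := choose_mul_pow_le (K+1) i (N+1) (by linarith) (by omega)
  rw [show N+1+1 = N+2 by ring] at this
  refine le_trans ?_ this
  have h1 : (N+a)^(K-i) ≤ (N+1)^(K-i) := pow_le_pow_left₀ (by linarith) (by linarith) _
  have h2 : (N+1)^(K-i) ≤ (N+1)^(K+1-i) := pow_le_pow_right₀ (by linarith) (by omega)
  exact mul_le_mul b2 (h1.trans h2) (pow_nonneg (by linarith) _) (by positivity)

lemma pade (t s r v z : ℤ) (K : ℕ) (hK : 0 < K) (ht : 0 < t) (hs : 0 < s) (hv : 0 < v) (hr : 0 ≤ r)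
    (hz : 0 ≤ z) (e1 : t^2 = 2*s^2+1) (e2 : v^2 = 2*r^2+1) (e3 : z^2 = (s^2+1)*r^2+s^2) (N : ℝ)
    (hN : N = (t:ℝ)^2) :
    1 ≤ (8:ℝ)^(K+1) * (N^K * (t*v) * ((1/4)^K * ((N⁻¹)^(3*K) / (1-N⁻¹)^(3*K+1)))
      + (t/v) * (N+2)^(K+1) * (3 * (27/4)^K)) := by
  have ht' : (0:ℝ) < t := by exact_mod_cast ht
  have hs' : (1:ℝ) ≤ s := by exact_mod_cast hs
  have hv' : (0:ℝ) < v := by exact_mod_cast hv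
  have hr' : (0:ℝ) ≤ r := by exact_mod_cast hr
  have hz' : (0:ℝ) ≤ z := by exact_mod_cast hz
  have e1' : (t:ℝ)^2 = 2*s^2+1 := by exact_mod_cast e1
  have e2' : (v:ℝ)^2 = 2*r^2+1 := by exact_mod_cast e2
  have e3' : (z:ℝ)^2 = (s^2+1)*r^2+s^2 := by exact_mod_cast e3
  have hN3 : 3 ≤ N := by rw [hN, e1']; nlinarith
  have hN0 : 0 < N := by linarith
  have hx0 : 0 ≤ N⁻¹ := by positivity
  have hx1 : N⁻¹ < 1 := inv_lt_one_of_one_lt₀ (by linarith)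
  set F := Fj K ((2*s*r : ℤ) : ℝ) N (-1) with hF
  set G := Fj K ((t*v : ℤ) : ℝ) N 0 with hG
  set H := Fj K ((2*z : ℤ) : ℝ) N 1 with hH
  -- integrality
  have int : ∀ p q r, p ≤ K+1 → q ≤ K+1 → r ≤ K+1 → ∃ z : ℤ, (8:ℝ)^(K+1) * dd F G H p q r = z := by
    intro p q r hp hq hr
    obtain ⟨w, hw⟩ := dd_int F G H (K+1) p q r hp hq hr
      (fun n _ => Fj_int K _ (2*s^2) N (-1) (by rw [hN, e1']; push_cast; ring) n)
      (fun n _ => Fj_int K _ (t^2) N 0 (by rw [hN]; push_cast; ring) n)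
      (fun n _ => Fj_int K _ (2*s^2+2) N 1 (by rw [hN, e1']; push_cast; ring) n)
    refine ⟨w, ?_⟩
    rw [← hw, pow_mul]; norm_num
  -- upper bound
  have ub : ∀ p q r, p ≤ K+1 → q ≤ K+1 → r ≤ K+1 → p + q + r = 3*K+1 →
      (3/2:ℝ)^p * 3^q * (3/2)^r ≤ 3 * (27/4)^K →
      |dd F G H p q r| ≤ N^K * (t*v) * ((1/4)^K * ((N⁻¹)^(3*K) / (1-N⁻¹)^(3*K+1)))
      + (t/v) * (N+2)^(K+1) * (3 * (27/4)^K) := by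
    intro p q l hp hq hl hm hb
    set Q : ℝ := t * v with hQ
    have c1 := dd_congr F G H
      (fun i => (N^K * Q) * gj K N⁻¹ (-1) i +
        1 * Fj K (((2*s*r : ℤ) : ℝ) - Real.sqrt (1 + (-1) * N⁻¹) * Q) N (-1) i)
      (fun i => (N^K * Q) * gj K N⁻¹ 0 i +
        1 * Fj K (((t*v : ℤ) : ℝ) - Real.sqrt (1 + 0 * N⁻¹) * Q) N 0 i)
      (fun i => (N^K * Q) * gj K N⁻¹ 1 i +
        1 * Fj K (((2*z : ℤ) : ℝ) - Real.sqrt (1 + 1 * N⁻¹) * Q) N 1 i) p q l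
      (fun i hi => Fj_split K _ _ N _ hN0 i (by omega))
      (fun i hi => Fj_split K _ _ N _ hN0 i (by omega))
      (fun i hi => Fj_split K _ _ N _ hN0 i (by omega))
    rw [c1, dd_comb]
    refine (abs_add_le _ _).trans (add_le_add ?_ ?_)
    · rw [abs_mul, abs_of_nonneg (show 0 ≤ N^K * Q by positivity)]
      exact mul_le_mul_of_nonneg_left (gj_bound K p q l _ hx0 hx1 hm hp hq hl) (by positivity)
    · rw [one_mul]
      have sq : ∀ a : ℝ, 0 < N + a → Real.sqrt (1 + a * N⁻¹) * Q = Real.sqrt (N+a) * v := by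
        intro a ha
        have : 1 + a * N⁻¹ = (N+a) / t^2 := by rw [hN]; field_simp
        rw [this, Real.sqrt_div ha.le, Real.sqrt_sq ht'.le, hQ]; field_simp
      have sl : ∀ a : ℝ, 0 ≤ N + a → -1 ≤ a → a ≤ 1 → (N - 1) ≤ t * Real.sqrt (N+a) := by
        intro a ha h1 h2
        have t1 : Real.sqrt (N-1) ≤ Real.sqrt (N+a) := Real.sqrt_le_sqrt (by linarith)
        have t2 : Real.sqrt (N-1) ≤ t := by
          rw [Real.sqrt_le_left ht'.le]; linarith
        have t3 := Real.mul_self_sqrt (show 0 ≤ N-1 by linarith)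
        rw [← t3]
        exact mul_le_mul t2 t1 (Real.sqrt_nonneg _) ht'.le
      have d1 : |((2*s*r : ℤ) : ℝ) - Real.sqrt (1 + (-1) * N⁻¹) * Q| ≤ t/v := by
        rw [sq _ (by linarith)]
        have p1 : 0 < Real.sqrt (N+(-1)) := Real.sqrt_pos.2 (by linarith)
        have p2 := Real.sq_sqrt (show 0 ≤ N+(-1) by linarith)
        have p3 := sl (-1) (by linarith) (by norm_num) (by norm_num)
        have p4 : (t:ℝ)/v * (Real.sqrt (N+(-1)) * v) = t * Real.sqrt (N+(-1)) := by field_simp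
        apply near_sqrt
        · push_cast; positivity
        · positivity
        · rw [p4, mul_pow, p2]
          refine le_trans ?_ p3
          have hs2 : 0 ≤ (s:ℝ)^2 := by positivity
          rw [e2', hN, e1']; push_cast; nlinarith
        · rw [p4, mul_pow, p2]
          refine le_trans ?_ p3
          rw [e2', hN, e1']; push_cast; nlinarith
      have d2 : |((t*v : ℤ) : ℝ) - Real.sqrt (1 + 0 * N⁻¹) * Q| ≤ t/v := by
        simp [hQ]; positivity
      have d3 : |((2*z : ℤ) : ℝ) - Real.sqrt (1 + 1 * N⁻¹) * Q| ≤ t/v := by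
        rw [sq _ (by linarith)]
        have p1 : 0 < Real.sqrt (N+1) := Real.sqrt_pos.2 (by linarith)
        have p2 := Real.sq_sqrt (show 0 ≤ N+1 by linarith)
        have p3 := sl 1 (by linarith) (by norm_num) (by norm_num)
        have p4 : (t:ℝ)/v * (Real.sqrt (N+1) * v) = t * Real.sqrt (N+1) := by field_simp
        apply near_sqrt
        · push_cast; positivity
        · positivity
        · rw [p4, mul_pow, p2]
          refine le_trans ?_ p3
          rw [e2', hN, e1']; push_cast; rw [mul_pow, e3']; nlinarith
        · rw [p4, mul_pow, p2]
          refine le_trans ?_ p3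
          rw [e2', hN, e1']; push_cast; rw [mul_pow, e3']; nlinarith
      have hB : 0 ≤ (t:ℝ)/v * (N+2)^(K+1) := by positivity
      have bb := dd_bound _ _ _ _ p q l hB
        (fun i hi => Fj_le K _ N (-1) _ (by linarith) (by norm_num) d1 i (by omega))
        (fun i hi => Fj_le K _ N 0 _ (by linarith) (by norm_num) d2 i (by omega))
        (fun i hi => Fj_le K _ N 1 _ (by linarith) (by norm_num) d3 i (by omega))
      refine bb.trans ?_
      rw [mul_assoc, mul_assoc, ← mul_assoc ((3/2:ℝ)^p)]
      exact mul_le_mul_of_nonneg_left hb hB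
  by_contra hlt
  push Not at hlt
  have zero : ∀ p q r, p ≤ K+1 → q ≤ K+1 → r ≤ K+1 → p + q + r = 3*K+1 →
      (3/2:ℝ)^p * 3^q * (3/2)^r ≤ 3 * (27/4)^K → dd F G H p q r = 0 := by
    intro p q r hp hq hr hm hb
    obtain ⟨w, hw⟩ := int p q r hp hq hr
    have h1 := ub p q r hp hq hr hm hb
    have h8 : (0:ℝ) < 8^(K+1) := by positivity
    have h2 : |(w:ℝ)| < 1 := by
      rw [← hw, abs_mul, abs_of_pos h8]
      exact lt_of_le_of_lt (mul_le_mul_of_nonneg_left h1 h8.le) hlt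
    have h3 : w = 0 := by
      rw [← Int.abs_lt_one_iff]; exact_mod_cast h2
    rw [h3] at hw
    simpa using hw
  have pw : (27/4:ℝ)^K = (3/2)^K * 3^K * (3/2)^K := by rw [← mul_pow, ← mul_pow]; norm_num
  have pp : (0:ℝ) < (3/2)^K * 3^K * (3/2)^K := by positivity
  have g0 := nonvanish K hK N (by linarith) F G H
    (fun i hi => by have := Fj_rec K ((2*s*r : ℤ) : ℝ) N (-1) i hi; exact this)
    (fun i hi => by have := Fj_rec K ((t*v : ℤ) : ℝ) N 0 i hi; rw [add_zero] at this; exact this)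
    (fun i hi => by have := Fj_rec K ((2*z : ℤ) : ℝ) N 1 i hi; exact this)
    (zero _ _ _ le_rfl (by omega) (by omega) (by ring) (by rw [pw, pow_succ]; linarith))
    (zero _ _ _ (by omega) le_rfl (by omega) (by ring) (by rw [pw, pow_succ]; linarith))
    (zero _ _ _ (by omega) (by omega) le_rfl (by ring) (by rw [pw, pow_succ]; linarith))
  have : G 0 = t * v * N^K := by simp [hG, Fj]
  rw [this] at g0
  exact absurd g0 (by positivity)


lemma pade_contra (t s r v z : ℤ) (ht : 17 ≤ t) (hs : 0 < s) (hv : 0 < v) (hr : 0 ≤ r)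
    (hz : 0 ≤ z) (e1 : t^2 = 2*s^2+1) (e2 : v^2 = 2*r^2+1) (e3 : z^2 = (s^2+1)*r^2+s^2)
    (hbig : t^136 ≤ v) : False := by
  have ht' : (17:ℝ) ≤ t := by exact_mod_cast ht
  have hv' : (0:ℝ) < v := by exact_mod_cast hv
  have hbig' : (t:ℝ)^136 ≤ v := by exact_mod_cast hbig
  obtain ⟨N, hN⟩ : ∃ N : ℝ, N = (t:ℝ)^2 := ⟨_, rfl⟩
  have hN289 : 289 ≤ N := by rw [hN]; nlinarith
  have hN0 : 0 < N := by linarith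
  have ht0 : (0:ℝ) < t := by linarith
  obtain ⟨Q, hQ⟩ : ∃ Q : ℝ, Q = 54 * (N+2) := ⟨_, rfl⟩
  obtain ⟨A, hA⟩ : ∃ A : ℝ, A = 48 * t * (N+2) := ⟨_, rfl⟩
  have hQ1 : 1 < Q := by rw [hQ]; linarith
  have hA0 : 0 < A := by rw [hA]; positivity
  have h35 : A * Q^35 < v := by
    refine lt_of_lt_of_le ?_ hbig'
    have q1 : Q ≤ 55 * t^2 := by rw [hQ, ← hN]; linarith
    have q2 : A ≤ 48 * t^4 := by
      rw [hA, show (48:ℝ) * t^4 = 48 * t * (t^3) by ring]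
      have : N + 2 ≤ (t:ℝ)^3 := by rw [pow_succ, ← hN]; nlinarith
      gcongr
    have q3 : (55:ℝ)^2 ≤ (t:ℝ)^3 := by
      calc (55:ℝ)^2 ≤ (17:ℝ)^3 := by norm_num
        _ ≤ (t:ℝ)^3 := by gcongr
    have q4 : (48*55:ℝ) ≤ (t:ℝ)^3 := by
      calc (48*55:ℝ) ≤ (17:ℝ)^3 := by norm_num
        _ ≤ (t:ℝ)^3 := by gcongr
    calc A * Q^35 ≤ (48 * (t:ℝ)^4) * (55 * (t:ℝ)^2)^35 := by gcongr
      _ = (48*55) * ((55:ℝ)^2)^17 * (t:ℝ)^74 := by ring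
      _ ≤ t^3 * (t^3)^17 * (t:ℝ)^74 := by gcongr
      _ = (t:ℝ)^128 := by ring
      _ < (t:ℝ)^136 := pow_lt_pow_right₀ (by linarith) (by norm_num)
  have hex : ∃ n : ℕ, (v:ℝ) ≤ A * Q^n := by
    obtain ⟨n, hn⟩ := pow_unbounded_of_one_lt (v/A) hQ1
    refine ⟨n, ?_⟩
    rw [div_lt_iff₀ hA0] at hn; linarith
  classical
  obtain ⟨K, hK1, hK2, hK35⟩ : ∃ K : ℕ, A * Q^K < v ∧ (v:ℝ) ≤ A * Q^(K+1) ∧ 35 ≤ K := by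
    have hm := Nat.find_spec hex
    have hlt : 35 < Nat.find hex := by
      by_contra hc
      push Not at hc
      have : Q^(Nat.find hex) ≤ Q^35 := pow_le_pow_right₀ hQ1.le hc
      have := mul_le_mul_of_nonneg_left this hA0.le
      linarith
    obtain ⟨K, hK⟩ : ∃ K, Nat.find hex = K + 1 := ⟨Nat.find hex - 1, by omega⟩
    refine ⟨K, ?_, hK ▸ hm, by omega⟩
    have := Nat.find_min hex (m := K) (by omega)
    push Not at this; exact this
  have P := pade t s r v z K (by omega) (by omega) hs hv hr hz e1 e2 e3 N hN
  rw [mul_add] at P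
  have T2 : (8:ℝ)^(K+1) * ((t/v) * (N+2)^(K+1) * (3 * (27/4)^K)) < 1/2 := by
    have : (8:ℝ)^(K+1) * ((t/v) * (N+2)^(K+1) * (3 * (27/4)^K)) = (A * Q^K / v) / 2 := by
      rw [hA, hQ, pow_succ, pow_succ, mul_pow, show (54:ℝ) = 8 * (27/4) by norm_num, mul_pow]
      ring
    rw [this]
    have : A * Q^K / v < 1 := (div_lt_one hv').2 hK1
    linarith
  have T1 : (8:ℝ)^(K+1) * (N^K * (t*v) * ((1/4)^K * ((N⁻¹)^(3*K) / (1-N⁻¹)^(3*K+1)))) < 1/2 := by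
    have x1 : N⁻¹ ≤ 1/289 := by rw [inv_le_comm₀ hN0 (by norm_num)]; linarith
    have x2 : (288/289:ℝ) ≤ 1 - N⁻¹ := by linarith
    have x3 : 1 / (1-N⁻¹)^(3*K+1) ≤ (289/288)^(3*K+1) := by
      rw [div_le_iff₀ (by apply pow_pos; linarith), ← mul_pow]
      apply one_le_pow₀; linarith
    have qn : Q ≤ 54.4 * N := by rw [hQ]; linarith
    have an : A * t * Q ≤ 48 * 1.01 * 54.4 * N^3 := by
      have : A * t = 48 * (N * (N+2)) := by rw [hA, hN]; ring
      rw [this]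
      calc 48 * (N * (N+2)) * Q ≤ 48 * (N * (1.01*N)) * (54.4*N) := by
            gcongr; linarith
        _ = _ := by ring
    obtain ⟨m, rfl⟩ := Nat.exists_eq_add_of_le hK35
    have y1 : (8:ℝ)^((35+m)+1) * (N^(35+m) * (t*v) * ((1/4)^(35+m) * ((N⁻¹)^(3*(35+m)) / (1-N⁻¹)^(3*(35+m)+1))))
        = 8 * t * v * (2 / N^2)^(35+m) * (1 / (1-N⁻¹)^(3*(35+m)+1)) := by
      have : (8:ℝ)^(35+m) * (N^(35+m) * ((1/4)^(35+m) * (N⁻¹)^(3*(35+m)))) = (2/N^2)^(35+m) := by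
        rw [pow_mul, ← mul_pow, ← mul_pow, ← mul_pow]
        congr 1; field_simp; norm_num
      rw [← this]; ring
    rw [y1]
    have y2 : 2 / N^2 * Q * (289/288)^3 ≤ 110/N := by
      rw [div_mul_eq_mul_div, div_mul_eq_mul_div, div_le_div_iff₀ (by positivity) hN0]
      nlinarith
    calc 8 * t * v * (2 / N^2)^(35+m) * (1 / (1-N⁻¹)^(3*(35+m)+1))
        ≤ 8 * t * (A * Q^((35+m)+1)) * (2 / N^2)^(35+m) * (289/288)^(3*(35+m)+1) := by
          gcongr
      _ = 8 * (289/288) * (A * t * Q) * (2 / N^2 * Q * (289/288)^3)^(35+m) := by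
          rw [mul_pow, mul_pow, ← pow_mul]; ring
      _ ≤ 8 * (289/288) * (48 * 1.01 * 54.4 * N^3) * (110/N)^(35+m) := by
          gcongr
      _ ≤ 8 * (289/288) * (48 * 1.01 * 54.4 * N^3) * ((110/N)^3 * (110/289)^32) := by
          have z0 : 110/N ≤ 110/289 := by gcongr
          have z1 : 110/N ≤ 1 := z0.trans (by norm_num)
          have z2 : 0 ≤ 110/N := by positivity
          have z3 : (110/N)^(35+m) ≤ (110/N)^3 * (110/289)^32 := by
            calc (110/N)^(35+m) ≤ (110/N)^35 := pow_le_pow_of_le_one z2 z1 (by omega)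
              _ = (110/N)^3 * (110/N)^32 := by ring
              _ ≤ _ := by gcongr
          gcongr
      _ = 8 * (289/288) * (48 * 1.01 * 54.4) * 110^3 * (110/289)^32 := by
          field_simp
      _ < 1/2 := by norm_num
  linarith


lemma pell_rep (a x y : ℕ) (a1 : 1 < a) (h : x^2 + y^2 = a^2 * y^2 + 1) :
    ∃ n, x = Pell.xn a1 n ∧ y = Pell.yn a1 n := by
  have h' : x * x - (a*a-1) * y * y = 1 := by
    rw [Nat.sub_mul, Nat.sub_mul]
    have e1 : x^2 = x * x := by ring
    have e2 : a^2*y^2 = a*a*y*y := by ring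
    have e3 : y^2 = 1*y*y := by ring
    have : 1*y*y ≤ a*a*y*y := by gcongr; nlinarith
    omega
  exact Pell.eq_pell a1 h'

lemma yn_two (a : ℕ) (a1 : 1 < a) : Pell.yn a1 2 = 2 * a := by
  rw [Pell.yn_succ, Pell.xn_one, Pell.yn_one]; ring

lemma yn_odd (a t : ℕ) (a1 : 1 < a) (ht : t ∣ a) (ht1 : t ≠ 1) (m : ℕ) :
    ¬ t ∣ Pell.yn a1 (2*m+1) := by
  induction m with
  | zero => simpa using ht1
  | succ m ih =>
    intro hc
    apply ih
    have h := Pell.yn_succ_succ a1 (2*m+1)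
    have h2 : t ∣ 2 * a * Pell.yn a1 (2*m+1+1) := by
      apply Dvd.dvd.mul_right; exact ht.mul_left 2
    rw [← h] at h2
    exact (Nat.dvd_add_right hc).1 h2

set_option maxRecDepth 100000 in
lemma small_t : ∀ t < 68, ∀ s < 48, t * t = 2 * (s * s) + 1 → 17 ≤ t → t = 17 ∧ s = 12 := by
  decide

lemma lower_bound (t s R v Z : ℕ) (ht : 17 ≤ t) (hR : 0 < R) (e1 : t^2 = 2*s^2+1)
    (e2 : v^2 = 2*s^2*R^2+1) (e3 : Z^2 = (s^2+1)*R^2+1) (hd : 2*s ∣ R) : t^136 ≤ v := by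
  have t1 : 1 < t := by omega
  obtain ⟨k, hk1, hk2⟩ := pell_rep t v R t1 (by rw [e2, e1]; ring)
  have kev : k % 2 = 0 := by
    have := Pell.yn_modEq_two t1 k
    rw [← hk2] at this
    have h2 : 2 ∣ R := (Dvd.intro _ rfl).trans hd
    unfold Nat.ModEq at this
    omega
  have hkd : ∃ k', k = 2 * k' := ⟨k/2, by omega⟩
  obtain ⟨R1, hR1⟩ := hd
  have hcop : Nat.Coprime t (2*s) := by
    have : Nat.Coprime (t^2) (2*s) := by
      rw [e1, show 2*s^2+1 = 1 + (2*s)*s by ring, Nat.coprime_add_mul_left_left]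
      exact Nat.coprime_one_left _
    exact Nat.Coprime.coprime_dvd_left (Dvd.intro _ (sq t).symm) this
  have tR1 : t ∣ R1 := by
    obtain ⟨k', hk'⟩ := hkd
    have := Pell.y_mul_dvd t1 2 k'
    rw [← hk', ← hk2, yn_two, hR1] at this
    exact hcop.dvd_of_dvd_mul_left ((Dvd.intro_left _ rfl).trans this)
  have t2 : 1 < t^2 := by nlinarith
  obtain ⟨j, hj1, hj2⟩ := pell_rep (t^2) Z R1 t2 (by rw [e3, e1, hR1]; ring)
  have jev : j % 2 = 0 := by
    by_contra hc
    have : j = 2*(j/2)+1 := by omega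
    have h := yn_odd (t^2) t t2 (Dvd.intro _ (sq t).symm) (by omega) (j/2)
    rw [← this, ← hj2] at h
    exact h tR1
  have hR2 : 2*t^2 ∣ R1 := by
    have := Pell.y_mul_dvd t2 2 (j/2)
    rw [show 2*(j/2) = j by omega, ← hj2, yn_two] at this
    exact this
  have h4 : 2*t ∣ k := by
    have : Pell.yn t1 2 * Pell.yn t1 2 ∣ Pell.yn t1 k := by
      rw [yn_two, ← hk2, hR1]
      calc 2*t*(2*t) ∣ (2*t*(2*t))*s := Dvd.intro _ rfl
        _ = 2*s*(2*t^2) := by ring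
        _ ∣ 2*s*R1 := Nat.mul_dvd_mul_left _ hR2
    have := Pell.dvd_of_ysq_dvd t1 this
    rwa [yn_two] at this
  have kpos : 0 < k := by
    rcases Nat.eq_zero_or_pos k with h | h
    · rw [h, Pell.yn_zero] at hk2; omega
    · exact h
  have k136 : 136 ≤ k := by
    rcases Nat.lt_or_ge t 68 with h | h
    · have hs : s < 48 := by nlinarith
      obtain ⟨rfl, rfl⟩ := small_t t h s hs (by linarith [e1, sq t, sq s]) ht
      have := Pell.yn_modEq_a_sub_one t1 k
      rw [← hk2, hR1] at this
      unfold Nat.ModEq at this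
      omega
    · have := Nat.le_of_dvd kpos h4; omega
  calc t^136 ≤ t^k := Nat.pow_le_pow_right (by omega) k136
    _ ≤ v := by rw [hk1]; exact Pell.xn_ge_a_pow t1 k

theorem cop4 (x y e : ℕ) (h : x * y = e ^ 4) (hc : Nat.Coprime x y) :
    ∃ p q, x = p ^ 4 ∧ y = q ^ 4 ∧ e = p * q := by
  have h1 : ∃ p, x = p ^ 4 := exists_eq_pow_of_mul_eq_pow (by
    rw [Nat.isUnit_iff]; exact hc) h
  have h2 : ∃ p, y = p ^ 4 := exists_eq_pow_of_mul_eq_pow (a := y) (b := x) (by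
    rw [Nat.isUnit_iff]; exact hc.symm) (by rw [mul_comm]; exact h)
  obtain ⟨p, rfl⟩ := h1
  obtain ⟨q, rfl⟩ := h2
  refine ⟨p, q, rfl, rfl, ?_⟩
  rw [← mul_pow] at h
  exact (Nat.pow_left_injective (n := 4) (by norm_num) h).symm

theorem sq_near (a n : ℕ) (h : a ^ 2 = n ^ 2 + 1) : n = 0 := by
  have h1 : n < a := by nlinarith
  nlinarith

theorem descent4 : ∀ e a : ℕ, a ^ 4 = 40 * e ^ 4 + 1 → e = 0 := by
  intro e
  induction e using Nat.strong_induction_on with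
  | _ e ih =>
  intro a h
  have p5 : Nat.Prime 5 := by norm_num
  rcases Nat.even_or_odd' a with ⟨k, rfl | rfl⟩
  · exfalso; ring_nf at h; omega
  have hY : (k ^ 2 + k) * (2 * (k ^ 2 + k) + 1) = 5 * e ^ 4 := by nlinarith
  obtain ⟨Y, hYd⟩ : ∃ Y, Y = k ^ 2 + k := ⟨_, rfl⟩
  have ha : (2 * k + 1) ^ 2 = 4 * Y + 1 := by rw [hYd]; ring
  rw [← hYd] at hY
  have hd : 5 ∣ Y * (2 * Y + 1) := ⟨_, hY⟩
  rcases p5.dvd_mul.mp hd with ⟨Y', h5⟩ | ⟨X, h5⟩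
  swap
  · rw [h5] at hY
    have hxy : Y * X = e ^ 4 := by nlinarith
    have hc : Nat.Coprime Y X := by
      have : Nat.Coprime Y (2 * Y + 1) := by simp
      rw [h5] at this
      exact Nat.Coprime.coprime_mul_left_right this
    obtain ⟨p, q, hp, hq, he⟩ := cop4 _ _ _ hxy hc
    have := sq_near (2 * k + 1) (2 * p ^ 2) (by rw [ha, hp]; ring)
    have : p = 0 := by simpa using this
    rw [he, this, zero_mul]
  · rw [h5] at hY
    have hxy : Y' * (10 * Y' + 1) = e ^ 4 := by nlinarith
    obtain ⟨w, u, hw, hu, he⟩ := cop4 _ _ _ hxy (by simp)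
    rw [hw] at hu
    have h2 : u ^ 4 = 10 * w ^ 4 + 1 := hu.symm
    rcases Nat.even_or_odd' u with ⟨l, rfl | rfl⟩
    · exfalso; ring_nf at h2; omega
    rcases Nat.even_or_odd' w with ⟨w1, rfl | rfl⟩
    swap
    · exfalso
      ring_nf at h2; omega
    have hZ : (l ^ 2 + l) * (2 * (l ^ 2 + l) + 1) = 20 * w1 ^ 4 := by nlinarith
    obtain ⟨V, hVd⟩ : ∃ V, V = l ^ 2 + l := ⟨_, rfl⟩
    have hb : (2 * l + 1) ^ 2 = 4 * V + 1 := by rw [hVd]; ring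
    rw [← hVd] at hZ
    have h4 : 4 ∣ V := by
      have : Nat.Coprime 4 (2 * V + 1) := by
        rw [show 4 = 2 ^ 2 by norm_num]
        apply Nat.Coprime.pow_left
        simp
      apply this.dvd_of_dvd_mul_right
      rw [hZ]; exact ⟨5 * w1 ^ 4, by ring⟩
    obtain ⟨Y, rfl⟩ := h4
    have hZ2 : Y * (8 * Y + 1) = 5 * w1 ^ 4 := by nlinarith
    have hd : 5 ∣ Y * (8 * Y + 1) := ⟨_, hZ2⟩
    rcases p5.dvd_mul.mp hd with ⟨Y2, h6⟩ | ⟨X, h6⟩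
    swap
    · rw [h6] at hZ2
      have hxy : Y * X = w1 ^ 4 := by nlinarith
      have hc : Nat.Coprime Y X := by
        have : Nat.Coprime Y (8 * Y + 1) := by simp
        rw [h6] at this
        exact Nat.Coprime.coprime_mul_left_right this
      obtain ⟨p, q, hp, hq, he2⟩ := cop4 _ _ _ hxy hc
      have := sq_near (2 * l + 1) (4 * p ^ 2) (by rw [hb, hp]; ring)
      have : p = 0 := by simpa using this
      rw [he, he2, this]; simp
    · rw [h6] at hZ2
      have hxy : Y2 * (40 * Y2 + 1) = w1 ^ 4 := by nlinarith
      obtain ⟨q, p, hq, hp, he2⟩ := cop4 _ _ _ hxy (by simp)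
      rw [hq] at hp
      by_contra hne
      have hq0 : q = 0 := by
        apply ih q _ p hp.symm
        rw [he, he2] at hne ⊢
        have hq1 : 0 < q := by
          rcases Nat.eq_zero_or_pos q with h | h
          · simp [h] at hne
          · exact h
        have hp1 : 0 < p := by
          rcases Nat.eq_zero_or_pos p with h | h
          · simp [h] at hne
          · exact h
        have e1 : q ≤ q * p := Nat.le_mul_of_pos_right _ hp1
        have e2 : q * p ≤ q * p * (2 * l + 1) := Nat.le_mul_of_pos_right _ (by omega)
        rw [mul_assoc]; omega
      apply hne
      rw [he, he2, hq0]; simp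

theorem coreC (v R Z S : ℕ) (h1 : v ^ 2 = 8 * R ^ 2 + 1) (h2 : Z ^ 2 = 5 * S ^ 2 + 1)
    (h3 : v * R = Z * S) : R = 0 := by
  have hv : 0 < v := by rcases Nat.eq_zero_or_pos v with h | h <;> [simp [h] at h1; exact h]
  obtain ⟨a, b, g, ha, hbg, hvb, hzg⟩ : ∃ a b g, 0 < a ∧ Nat.Coprime b g ∧ v = b * a ∧ Z = g * a := by
    obtain ⟨b, g, h, h', h''⟩ := Nat.exists_coprime v Z
    exact ⟨_, b, g, Nat.gcd_pos_of_pos_left _ hv, h, h', h''⟩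
  subst hvb hzg
  have hb : 0 < b := Nat.pos_of_mul_pos_right hv
  have h4 : b * R = g * S := by
    apply Nat.eq_of_mul_eq_mul_left ha; nlinarith
  obtain ⟨e, rfl⟩ : b ∣ S := hbg.dvd_of_dvd_mul_left ⟨R, h4.symm⟩
  have hR : R = g * e := by
    apply Nat.eq_of_mul_eq_mul_left hb; nlinarith
  subst hR
  have h5 : b ^ 2 * (a ^ 2 + 5 * e ^ 2) = g ^ 2 * (a ^ 2 + 8 * e ^ 2) := by nlinarith
  have hcop : Nat.Coprime (b ^ 2) (g ^ 2) := hbg.pow 2 2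
  obtain ⟨w, hw⟩ : b ^ 2 ∣ a ^ 2 + 8 * e ^ 2 := hcop.dvd_of_dvd_mul_left ⟨_, h5.symm⟩
  have hw2 : a ^ 2 + 5 * e ^ 2 = g ^ 2 * w := by
    apply Nat.eq_of_mul_eq_mul_left (pow_pos hb 2); rw [h5, hw]; ring
  have hae : IsCoprime ((a : ℤ) ^ 2) ((e : ℤ) ^ 2) := by
    refine ⟨b ^ 2, - 8 * g ^ 2, ?_⟩
    have : ((b : ℤ) * a) ^ 2 = 8 * (g * e) ^ 2 + 1 := by exact_mod_cast h1
    linarith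
  have w1 : (w : ℤ) ∣ 3 * e ^ 2 := by
    refine ⟨(b : ℤ) ^ 2 - g ^ 2, ?_⟩
    zify at hw hw2
    linarith
  have w2 : (w : ℤ) ∣ 3 * a ^ 2 := by
    refine ⟨8 * (g : ℤ) ^ 2 - 5 * b ^ 2, ?_⟩
    zify at hw hw2
    linarith
  have w3 : (w : ℤ) ∣ 3 := by
    obtain ⟨p, q, hpq⟩ := hae
    have : (3 : ℤ) = p * (3 * a ^ 2) + q * (3 * e ^ 2) := by linear_combination -3 * hpq
    rw [this]
    exact dvd_add (w2.mul_left _) (w1.mul_left _)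
  have w4 : w ∣ 3 := by exact_mod_cast w3
  rcases (Nat.dvd_prime Nat.prime_three).mp w4 with rfl | rfl
  · have : a ^ 4 = 40 * e ^ 4 + 1 := by
      rw [mul_one] at hw hw2
      have : b ^ 2 * a ^ 2 = 8 * (g ^ 2 * e ^ 2) + 1 := by nlinarith
      rw [← hw, ← hw2] at this
      nlinarith
    rw [descent4 _ _ this, mul_zero]
  · exfalso
    have hodd : Odd (b * a) := by
      have : Odd ((b * a) ^ 2) := ⟨4 * (g * e) ^ 2, by rw [h1]; ring⟩
      exact Nat.Odd.of_mul_left (by rwa [sq] at this)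
    have ho1 := Nat.odd_mul.mp hodd
    obtain ⟨k, rfl⟩ := ho1.1
    obtain ⟨l, rfl⟩ := ho1.2
    ring_nf at hw
    omega

theorem partC (v R Z : ℕ) (h1 : v ^ 2 = 8 * R ^ 2 + 1) (h2 : Z ^ 2 = 5 * R ^ 2 + 1)
    (h4 : 4 ∣ R) : R = 0 := by
  have a3 : 1 < 3 := by norm_num
  have a9 : 1 < 9 := by norm_num
  obtain ⟨k, hvk, hRk⟩ := pell_rep 3 v R a3 (by rw [h1]; ring)
  have hk : k % 2 = 0 := by
    have := Pell.yn_modEq_two a3 k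
    rw [← hRk] at this
    unfold Nat.ModEq at this
    omega
  obtain ⟨m, rfl⟩ : ∃ m, k = m + m := ⟨k / 2, by omega⟩
  obtain ⟨R1, rfl⟩ := h4
  obtain ⟨j, hZj, hRj⟩ := pell_rep 9 Z R1 a9 (by rw [h2]; ring)
  have hm6 : Pell.yn a3 2 ∣ Pell.yn a3 (m + m) := by
    rw [← two_mul]; exact Pell.y_mul_dvd a3 2 m
  have h3 : 3 ∣ R1 := by
    rw [yn_two, ← hRk] at hm6
    have : 3 ∣ 4 * R1 := Dvd.dvd.trans ⟨2, by norm_num⟩ hm6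
    omega
  have hj : ∃ n, j = n + n := by
    rcases Nat.even_or_odd' j with ⟨n, hn | hn⟩
    · exact ⟨n, by omega⟩
    · exfalso
      rw [hRj, hn] at h3
      exact yn_odd 9 3 a9 (by norm_num) (by norm_num) n h3
  obtain ⟨n, rfl⟩ := hj
  rw [Pell.yn_add] at hRk hRj
  have q1 : Pell.xn a3 m * Pell.xn a3 m - 8 * Pell.yn a3 m * Pell.yn a3 m = 1 :=
    Pell.pell_eq a3 m
  have q2 : Pell.xn a9 n * Pell.xn a9 n - 80 * Pell.yn a9 n * Pell.yn a9 n = 1 :=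
    Pell.pell_eq a9 n
  have r1 : Pell.xn a3 m ^ 2 = 8 * Pell.yn a3 m ^ 2 + 1 := by
    rw [sq, sq, ← mul_assoc]; omega
  have r2 : Pell.xn a9 n ^ 2 = 5 * (4 * Pell.yn a9 n) ^ 2 + 1 := by
    have : 5 * (4 * Pell.yn a9 n) ^ 2 = 80 * Pell.yn a9 n * Pell.yn a9 n := by ring
    rw [this, sq]; omega
  have := coreC _ _ _ _ r1 r2 (by nlinarith)
  rw [this] at hRk
  simpa using hRk

theorem desc1 (s t : ℤ) (hs : 0 < s) (ht : t ^ 2 = 2 * s ^ 2 + 1) : ∀ n : ℕ, ∀ r z : ℤ,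
    r.natAbs = n → z ^ 2 = (s ^ 2 + 1) * r ^ 2 + s ^ 2 →
    ∃ r0 z0 : ℤ, z0 ^ 2 = (s ^ 2 + 1) * r0 ^ 2 + s ^ 2 ∧ z0 ^ 2 < (s ^ 2 + 1) ^ 2 ∧
      (2 * (s ^ 2 + 1) ∣ z - z0 ∨ 2 * (s ^ 2 + 1) ∣ z + z0) ∧
      (s ∣ z0 → 2 * s ^ 2 ∣ r0 → s ∣ z ∧ 2 * s ^ 2 ∣ r) := by
  intro n
  induction n using Nat.strong_induction_on with
  | _ n ih =>
  have key : ∀ r z : ℤ, 0 ≤ r → 0 ≤ z → r.natAbs = n → z ^ 2 = (s ^ 2 + 1) * r ^ 2 + s ^ 2 →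
    ∃ r0 z0 : ℤ, z0 ^ 2 = (s ^ 2 + 1) * r0 ^ 2 + s ^ 2 ∧ z0 ^ 2 < (s ^ 2 + 1) ^ 2 ∧
      (2 * (s ^ 2 + 1) ∣ z - z0 ∨ 2 * (s ^ 2 + 1) ∣ z + z0) ∧
      (s ∣ z0 → 2 * s ^ 2 ∣ r0 → s ∣ z ∧ 2 * s ^ 2 ∣ r) := by
    intro r z hr hz hn h
    by_cases hsm : (s ^ 2 + 1) * r ^ 2 ≤ s ^ 4
    · exact ⟨r, z, h, by nlinarith [sq_nonneg s], Or.inl (by simp), fun a b => ⟨a, b⟩⟩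
    push Not at hsm
    have b1 : s * r < z := by
      apply lt_of_pow_lt_pow_left₀ 2 hz
      rw [h]; nlinarith [sq_nonneg r, pow_pos hs 2]
    have b2 : s * z < (s ^ 2 + 1) * r := by
      apply lt_of_pow_lt_pow_left₀ 2 (by positivity)
      rw [mul_pow, h]; nlinarith
    have hlt : ((2 * s ^ 2 + 1) * r - 2 * s * z).natAbs < n := by
      rw [← hn]
      have : |(2 * s ^ 2 + 1) * r - 2 * s * z| < r := by
        rw [abs_lt]; constructor <;> nlinarith
      replace this := this.trans_le (le_abs_self r)
      rw [Int.abs_eq_natAbs, Int.abs_eq_natAbs] at this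
      exact_mod_cast this
    obtain ⟨r0, z0, e1, e2, e3, e4⟩ := ih _ hlt ((2 * s ^ 2 + 1) * r - 2 * s * z)
      ((2 * s ^ 2 + 1) * z - 2 * s * (s ^ 2 + 1) * r) rfl (by linear_combination h)
    refine ⟨r0, z0, e1, e2, ?_, ?_⟩
    · rcases e3 with ⟨k, hk⟩ | ⟨k, hk⟩
      · right; exact ⟨z - s * r - k, by linear_combination -hk⟩
      · left; exact ⟨z - s * r - k, by linear_combination -hk⟩
    · intro a b
      obtain ⟨⟨p, hp⟩, ⟨q, hq⟩⟩ := e4 a b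
      have hsz : s ∣ z := ⟨p - 2 * s * z + 2 * (s ^ 2 + 1) * r, by linear_combination hp⟩
      refine ⟨hsz, ?_⟩
      obtain ⟨m, rfl⟩ := hsz
      exact ⟨q - r + m, by linear_combination hq⟩
  intro r z hn h
  obtain ⟨r0, z0, e1, e2, e3, e4⟩ := key |r| |z| (abs_nonneg _) (abs_nonneg _) (by rw [Int.natAbs_abs]; exact hn)
    (by simpa using h)
  refine ⟨r0, z0, e1, e2, ?_, by simpa using e4⟩
  rcases abs_cases z with ⟨h, -⟩ | ⟨h, -⟩ <;> rw [h] at e3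
  · exact e3
  · rcases e3 with ⟨k, hk⟩ | ⟨k, hk⟩
    · right; exact ⟨-k, by linear_combination -hk⟩
    · left; exact ⟨-k, by linear_combination -hk⟩

theorem desc2 (c t : ℤ) (hc : 2 < c) (ht0 : 0 < t) (ht : t ^ 2 = 2 * c - 1) :
    ∀ n : ℕ, ∀ v z : ℤ,
    v.natAbs = n → 2 * z ^ 2 = c * v ^ 2 + c - 2 →
    ∃ v0 z0 : ℤ, 2 * z0 ^ 2 = c * v0 ^ 2 + c - 2 ∧ z0 ^ 2 < c ^ 2 ∧
      (2 * c ∣ z - z0 ∨ 2 * c ∣ z + z0) := by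
  intro n
  induction n using Nat.strong_induction_on with
  | _ n ih =>
  have key : ∀ v z : ℤ, 0 ≤ v → 0 ≤ z → v.natAbs = n → 2 * z ^ 2 = c * v ^ 2 + c - 2 →
    ∃ v0 z0 : ℤ, 2 * z0 ^ 2 = c * v0 ^ 2 + c - 2 ∧ z0 ^ 2 < c ^ 2 ∧
      (2 * c ∣ z - z0 ∨ 2 * c ∣ z + z0) := by
    intro v z hv hz hn h
    by_cases hsm : c * v ^ 2 ≤ (2 * c - 1) * (c - 2)
    · exact ⟨v, z, h, by nlinarith, Or.inl (by simp)⟩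
    push Not at hsm
    have b1 : t * v < 2 * z := by
      apply lt_of_pow_lt_pow_left₀ 2 (by positivity)
      rw [mul_pow, ht]; nlinarith [sq_nonneg v]
    have b2 : t * z < c * v := by
      apply lt_of_pow_lt_pow_left₀ 2 (by positivity)
      rw [mul_pow, ht]; nlinarith
    have hlt : ((4 * c - 1) * v - 4 * t * z).natAbs < n := by
      rw [← hn]
      have : |(4 * c - 1) * v - 4 * t * z| < v := by
        rw [abs_lt]; constructor <;> nlinarith
      replace this := this.trans_le (le_abs_self v)
      rw [Int.abs_eq_natAbs, Int.abs_eq_natAbs] at this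
      exact_mod_cast this
    obtain ⟨v0, z0, e1, e2, e3⟩ := ih _ hlt ((4 * c - 1) * v - 4 * t * z)
      ((4 * c - 1) * z - 2 * t * c * v) rfl
      (by linear_combination h + (8 * c ^ 2 * v ^ 2 - 16 * c * z ^ 2) * ht)
    refine ⟨v0, z0, e1, e2, ?_⟩
    rcases e3 with ⟨k, hk⟩ | ⟨k, hk⟩
    · right; exact ⟨2 * z - t * v - k, by linear_combination -hk⟩
    · left; exact ⟨2 * z - t * v - k, by linear_combination -hk⟩
  intro v z hn h
  obtain ⟨v0, z0, e1, e2, e3⟩ := key |v| |z| (abs_nonneg _) (abs_nonneg _) (by rw [Int.natAbs_abs]; exact hn)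
    (by simpa using h)
  refine ⟨v0, z0, e1, e2, ?_⟩
  rcases abs_cases z with ⟨h, -⟩ | ⟨h, -⟩ <;> rw [h] at e3
  · exact e3
  · rcases e3 with ⟨k, hk⟩ | ⟨k, hk⟩
    · right; exact ⟨-k, by linear_combination -hk⟩
    · left; exact ⟨-k, by linear_combination -hk⟩

theorem sq_eq_of_congr (c x y : ℤ) (hc : 0 < c) (hx : x ^ 2 < c ^ 2) (hy : y ^ 2 < c ^ 2)
    (h : 2 * c ∣ x - y ∨ 2 * c ∣ x + y) : x ^ 2 = y ^ 2 := by
  have h1 := abs_lt_of_sq_lt_sq' hx hc.le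
  have h2 := abs_lt_of_sq_lt_sq' hy hc.le
  rcases h with h | h
  · have := Int.eq_zero_of_abs_lt_dvd h (by rw [abs_lt]; constructor <;> linarith)
    rw [sub_eq_zero.mp this]
  · have := Int.eq_zero_of_abs_lt_dvd h (by rw [abs_lt]; constructor <;> linarith)
    rw [eq_neg_of_add_eq_zero_left this]; ring

theorem final_case (s t R v Z : ℕ) (hs : 1 < s) (hR : 0 < R) (e1 : t ^ 2 = 2 * s ^ 2 + 1)
    (e2 : v ^ 2 = 2 * s ^ 2 * R ^ 2 + 1) (e3 : Z ^ 2 = (s ^ 2 + 1) * R ^ 2 + 1)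
    (hd : 2 * s ∣ R) : False := by
  by_cases h2 : s = 2
  · subst h2
    have := partC v R Z (by rw [e2]; ring) (by rw [e3]; ring) hd
    omega
  · have ht : 17 ≤ t := by
      by_contra hlt
      push Not at hlt
      have : s < 12 := by nlinarith
      interval_cases s <;> interval_cases t <;> omega
    have hb := lower_bound t s R v Z ht hR e1 e2 e3 hd
    have hv : 0 < v := by
      rcases Nat.eq_zero_or_pos v with h | h
      · simp [h] at e2
      · exact h
    refine pade_contra t s (s * R) v (s * Z) (by exact_mod_cast ht) (by omega)
      (by exact_mod_cast hv) (by positivity) (by positivity) (by exact_mod_cast e1) ?_ ?_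
      (by exact_mod_cast hb)
    · zify at e2; rw [e2]; ring
    · zify at e3; rw [mul_pow, e3]; ring

theorem main_aux : ∀ n : ℕ, ∀ s t r v z : ℤ, s.natAbs = n → s ≠ 0 → s ^ 2 < r ^ 2 →
    t ^ 2 = 2 * s ^ 2 + 1 → v ^ 2 = 2 * r ^ 2 + 1 → z ^ 2 = (s ^ 2 + 1) * r ^ 2 + s ^ 2 →
    False := by
  intro n
  induction n using Nat.strong_induction_on with
  | _ n ih =>
  have key : ∀ s t r v z : ℤ, s.natAbs = n → 0 < s → 0 < t → s ^ 2 < r ^ 2 →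
    t ^ 2 = 2 * s ^ 2 + 1 → v ^ 2 = 2 * r ^ 2 + 1 → z ^ 2 = (s ^ 2 + 1) * r ^ 2 + s ^ 2 →
    False := by
    intro s t r v z hn hs ht hsr e1 e2 e3
    have hs1 : 1 < s := by
      by_contra h
      have : s = 1 := by omega
      subst this
      have : t < 2 := by nlinarith
      have : t = 1 := by omega
      subst this
      norm_num at e1
    obtain ⟨r0, z0, a1, a2, a3, a4⟩ := desc1 s t hs e1 _ r z rfl e3
    obtain ⟨v0, y0, b1, b2, b3⟩ := desc2 (s ^ 2 + 1) t (by nlinarith) ht (by linarith) _ v z rfl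
      (by rw [e2, e3]; ring)
    have hzy : z0 ^ 2 = y0 ^ 2 := by
      refine sq_eq_of_congr (s ^ 2 + 1) z0 y0 (by positivity) a2 b2 ?_
      rcases a3 with ⟨k, hk⟩ | ⟨k, hk⟩ <;> rcases b3 with ⟨l, hl⟩ | ⟨l, hl⟩
      · left; exact ⟨l - k, by linear_combination hl - hk⟩
      · right; exact ⟨l - k, by linear_combination hl - hk⟩
      · right; exact ⟨k - l, by linear_combination hk - hl⟩
      · left; exact ⟨k - l, by linear_combination hk - hl⟩
    have hv0 : v0 ^ 2 = 2 * r0 ^ 2 + 1 := by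
      have hc : (s ^ 2 + 1) ≠ 0 := by positivity
      apply mul_left_cancel₀ hc
      rw [← hzy] at b1
      linarith
    have hrs : r0 ^ 2 < s ^ 2 := by
      have h1 := abs_lt_of_sq_lt_sq' a2 (by positivity)
      have : z0 ^ 2 ≤ (s ^ 2) ^ 2 := sq_le_sq' (by linarith) (by linarith)
      by_contra hcon
      push Not at hcon
      nlinarith [sq_nonneg s]
    by_cases hr0 : r0 = 0
    · subst hr0
      have hz0 : s ∣ z0 := by
        have : z0 ^ 2 = s ^ 2 := by linarith
        rcases sq_eq_sq_iff_eq_or_eq_neg.mp this with h | h <;> rw [h]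
        simp
      obtain ⟨⟨Z, rfl⟩, ⟨k, rfl⟩⟩ := a4 hz0 (dvd_zero _)
      have hZ : Z ^ 2 = (s ^ 2 + 1) * (2 * s * k) ^ 2 + 1 := by
        apply mul_left_cancel₀ (pow_ne_zero 2 hs.ne')
        linarith
      refine final_case s.natAbs t.natAbs (2 * s * k).natAbs v.natAbs Z.natAbs (by omega) ?_ ?_ ?_
        ?_ ?_
      · apply Int.natAbs_pos.mpr
        intro h
        have : 2 * s ^ 2 * k = 0 := by linear_combination s * h
        rw [this] at hsr
        nlinarith
      · zify; simpa using e1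
      · zify; simp only [sq_abs]; rw [e2]; ring
      · zify; simp only [sq_abs]; exact hZ
      · rw [Int.natAbs_mul, Int.natAbs_mul]; exact Dvd.intro _ rfl
    · refine ih r0.natAbs ?_ r0 v0 s t z0 rfl hr0 hrs hv0 e1 (by rw [a1]; ring)
      rw [← hn]
      exact Int.natAbs_lt_iff_sq_lt.mpr hrs
  intro s t r v z hn hs hsr e1 e2 e3
  have ht : t ≠ 0 := by rintro rfl; nlinarith [sq_nonneg s]
  exact key |s| |t| r v z (by rw [Int.natAbs_abs]; exact hn) (abs_pos.mpr hs) (abs_pos.mpr ht) (by simpa using hsr)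
    (by simpa using e1) e2 (by simpa using e3)

theorem stmt_12 (c d : ℤ) (hc : 0 < c) (hd : 0 < d)
    (hc1 : c ≠ 1) (hc2 : c ≠ 2) (hd1 : d ≠ 1) (hd2 : d ≠ 2) (hcd : c ≠ d) :
    ¬ (IsSquare (c - 1) ∧ IsSquare (2*c - 1) ∧ IsSquare (d - 1) ∧
       IsSquare (2*d - 1) ∧ IsSquare (c*d - 1)) := by
  rintro ⟨⟨s, hs⟩, ⟨t, ht⟩, ⟨r, hr⟩, ⟨v, hv⟩, ⟨z, hz⟩⟩
  obtain rfl : c = s * s + 1 := by linarith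
  obtain rfl : d = r * r + 1 := by linarith
  have hs0 : s ≠ 0 := by rintro rfl; simp at hc1
  have hr0 : r ≠ 0 := by rintro rfl; simp at hd1
  have hne : s ^ 2 ≠ r ^ 2 := by
    intro h; apply hcd; linarith
  rcases lt_or_gt_of_ne hne with h | h
  · exact main_aux _ s t r v z rfl hs0 h (by linarith) (by linarith) (by linarith)
  · exact main_aux _ r v s t z rfl hr0 h (by linarith) (by linarith) (by linarith)
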